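/- arXiv:2111.13698 — 2 statements merged into one kernel-verified Lean document; each statement's English description precedes it below -/
import Mathlib

section
/- Let K be an algebraically closed field of characteristic zero, n ≥ 3, and λ ∈ K. Then every trace zero matrix in M_n(K) is in the image of the polynomial f(x₁,x₂,x₃) = [x₁,x₂][x₁,x₃] + λ[x₁,x₃][x₁,x₂] evaluated on M_n(K). -/
open Matrix

/-- `f(A, B, C) = [A, B][A, C] + lam [A, C][A, B]` takes the value `D` for some `A, B, C`. -/
def InImage {R M : Type*} [Ring M] [SMul R M] (lam : R) (D : M) : Prop :=
  ∃ A B C : M, D = (A * B - B * A) * (A * C - C * A) +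
    lam • ((A * C - C * A) * (A * B - B * A))

theorem InImage.of_conj {R M : Type*} [CommRing R] [Ring M] [Algebra R M] {lam : R} {D T S : M}
    (hS : IsUnit S) (h : D * S = S * T) (hT : InImage lam T) : InImage lam D := by
  obtain ⟨u, rfl⟩ := hS
  obtain ⟨A, B, C, rfl⟩ := hT
  refine ⟨u * A * ↑u⁻¹, u * B * ↑u⁻¹, u * C * ↑u⁻¹, ?_⟩
  have hc (X Y : M) : (u * X * ↑u⁻¹ : M) * (u * Y * ↑u⁻¹) = u * (X * Y) * ↑u⁻¹ := by
    simp [mul_assoc]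
  rw [← Units.eq_mul_inv_iff_mul_eq] at h
  simp only [hc, ← mul_sub, ← sub_mul, h]
  simp only [mul_add, add_mul, mul_smul_comm, smul_mul_assoc]

section Triangular

variable {K : Type*} [Field K]

open Polynomial in
theorem charpoly_eq_of_column_zero {n : ℕ} (D : Matrix (Fin (n + 1)) (Fin (n + 1)) K)
    (h : ∀ i : Fin n, D i.succ 0 = 0) :
    D.charpoly = (X - C (D 0 0)) * (D.submatrix Fin.succ Fin.succ).charpoly := by
  rw [Matrix.charpoly, Matrix.det_succ_column_zero, Fin.sum_univ_succ]
  rw [Finset.sum_eq_zero (fun i _ => by simp [h]), Matrix.charpoly]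
  have : (D.charmatrix.submatrix (Fin.succAbove 0) Fin.succ) =
      (D.submatrix Fin.succ Fin.succ).charmatrix := by
    ext1 i j
    simp [charmatrix_apply, Matrix.diagonal_apply]
  rw [this]
  simp

theorem exists_isUnit_mulVec_single {n : ℕ} {v : Fin (n + 1) → K} (hv : v ≠ 0) :
    ∃ S : Matrix (Fin (n + 1)) (Fin (n + 1)) K, IsUnit S ∧ S *ᵥ Pi.single 0 1 = v := by
  have he : (Pi.single 0 1 : Fin (n + 1) → K) ≠ 0 := by simp
  let φ := (LinearEquiv.toSpanNonzeroSingleton K _ _ he).symm.trans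
    (LinearEquiv.toSpanNonzeroSingleton K _ _ hv)
  obtain ⟨g, hg⟩ := Submodule.exists_linearEquiv_restrict_eq φ
  refine ⟨LinearMap.toMatrix' g.toLinearMap, ?_, ?_⟩
  · have : IsUnit (g.toLinearMap : Module.End K (Fin (n + 1) → K)) :=
      (Module.End.isUnit_iff _).2 g.bijective
    exact this.map LinearMap.toMatrixAlgEquiv'
  · rw [LinearMap.toMatrix'_mulVec]
    have := hg (LinearEquiv.toSpanNonzeroSingleton K _ _ he 1)
    rw [LinearEquiv.trans_apply, LinearEquiv.symm_apply_apply] at this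
    simpa using this.symm

open Polynomial in
theorem exists_mulVec_eq_smul_of_isRoot {n : Type*} [Fintype n] [DecidableEq n]
    {D : Matrix n n K} {c : K} (h : D.charpoly.IsRoot c) : ∃ v ≠ 0, D *ᵥ v = c • v := by
  rw [IsRoot, Matrix.eval_charpoly] at h
  obtain ⟨v, hv, hDv⟩ := Matrix.exists_mulVec_eq_zero_iff.2 h
  refine ⟨v, hv, ?_⟩
  rw [Matrix.sub_mulVec, sub_eq_zero] at hDv
  simpa using hDv.symm

open Polynomial in
theorem exists_upperTriangular {n : ℕ} (D : Matrix (Fin n) (Fin n) K) (d : Fin n → K)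
    (h : D.charpoly = ∏ i, (X - C (d i))) :
    ∃ S T : Matrix (Fin n) (Fin n) K, IsUnit S ∧ D * S = S * T ∧
      (∀ i j, j < i → T i j = 0) ∧ ∀ i, T i i = d i := by
  induction n with
  | zero => exact ⟨1, D, isUnit_one, by simp, fun i => i.elim0, fun i => i.elim0⟩
  | succ n ih =>
    obtain ⟨v, hv, hDv⟩ : ∃ v ≠ 0, D *ᵥ v = d 0 • v := by
      apply exists_mulVec_eq_smul_of_isRoot
      rw [h, IsRoot, eval_prod]
      exact Finset.prod_eq_zero (Finset.mem_univ 0) (by simp)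
    obtain ⟨_, ⟨u, rfl⟩, hu⟩ := exists_isUnit_mulVec_single hv
    set D₁ : Matrix _ _ K := u⁻¹.val * D * u.val with hD₁
    have hcol : D₁ *ᵥ Pi.single 0 1 = d 0 • Pi.single 0 1 := by
      rw [hD₁, ← Matrix.mulVec_mulVec, hu, ← Matrix.mulVec_mulVec, hDv, Matrix.mulVec_smul, ← hu,
        Matrix.mulVec_mulVec, Units.inv_mul, Matrix.one_mulVec]
    have hcol0 : D₁ 0 0 = d 0 := by simpa using congrFun hcol 0
    have hcols (i : Fin n) : D₁ i.succ 0 = 0 := by simpa using congrFun hcol i.succ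
    have hch := charpoly_eq_of_column_zero D₁ hcols
    have hDD : D₁.charpoly = D.charpoly := by
      rw [hD₁, Matrix.mul_assoc, Matrix.charpoly_mul_comm, Matrix.mul_assoc]
      simp
    rw [hDD, h, Fin.prod_univ_succ, hcol0] at hch
    obtain ⟨S', T', ⟨w, rfl⟩, hST, htri, hdiag⟩ := ih (D₁.submatrix Fin.succ Fin.succ)
      (fun i => d i.succ) (mul_left_cancel₀ (X_sub_C_ne_zero _) hch).symm
    let ext (M : Matrix (Fin n) (Fin n) K) : Matrix (Fin (n + 1)) (Fin (n + 1)) K :=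
      Matrix.of (Fin.cons (Fin.cons 1 0) fun i => Fin.cons 0 (M i))
    have hext (M N : Matrix (Fin n) (Fin n) K) : ext M * ext N = ext (M * N) := by
      ext i j
      refine Fin.cases ?_ (fun i => ?_) i <;> refine Fin.cases ?_ (fun j => ?_) j <;>
        simp [ext, Matrix.mul_apply, Fin.sum_univ_succ]
    have hext1 : ext 1 = 1 := by
      ext i j
      refine Fin.cases ?_ (fun i => ?_) i <;> refine Fin.cases ?_ (fun j => ?_) j <;>
        simp [ext, Matrix.one_apply, Fin.succ_ne_zero, (Fin.succ_ne_zero _).symm]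
    have hunit : IsUnit (ext w.val) :=
      ⟨⟨ext w.val, ext w⁻¹.val, by simp [hext, hext1], by simp [hext, hext1]⟩, rfl⟩
    let T : Matrix (Fin (n + 1)) (Fin (n + 1)) K :=
      Matrix.of (Fin.cons (Fin.cons (d 0) ((fun j => D₁ 0 j.succ) ᵥ* w.val))
        fun i => Fin.cons 0 (T' i))
    have hT : D₁ * ext w.val = ext w.val * T := by
      ext i j
      refine Fin.cases ?_ (fun i => ?_) i <;> refine Fin.cases ?_ (fun j => ?_) j
      · simp [ext, T, Matrix.mul_apply, Fin.sum_univ_succ, hcol0]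
      · simp [ext, T, Matrix.mul_apply, Fin.sum_univ_succ, Matrix.vecMul, dotProduct]
      · simp [ext, T, Matrix.mul_apply, Fin.sum_univ_succ, hcols]
      · simpa [ext, T, Matrix.mul_apply, Fin.sum_univ_succ] using congrFun (congrFun hST i) j
    refine ⟨u.val * ext w.val, T, u.isUnit.mul hunit, ?_, ?_, ?_⟩
    · rw [Matrix.mul_assoc, ← hT, hD₁]
      simp [← Matrix.mul_assoc]
    · intro i j
      refine Fin.cases ?_ (fun i => ?_) i
      · intro h; exact absurd h (Fin.not_lt_zero _)
      · refine Fin.cases ?_ (fun j => ?_) j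
        · simp [T]
        · simpa [T] using htri i j
    · intro i
      refine Fin.cases ?_ (fun i => ?_) i
      · simp [T]
      · simpa [T] using hdiag i

open Polynomial in
theorem exists_diagonal {n : ℕ} (D : Matrix (Fin n) (Fin n) K) (d : Fin n → K)
    (h : D.charpoly = ∏ i, (X - C (d i))) (hd : Function.Injective d) :
    ∃ S : Matrix (Fin n) (Fin n) K, IsUnit S ∧ D * S = S * Matrix.diagonal d := by
  have hv (i : Fin n) : ∃ v ≠ 0, D *ᵥ v = d i • v := by
    apply exists_mulVec_eq_smul_of_isRoot
    rw [h, IsRoot, eval_prod]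
    exact Finset.prod_eq_zero (Finset.mem_univ i) (by simp)
  choose v hv0 hDv using hv
  have hli : LinearIndependent K v := by
    refine Module.End.eigenvectors_linearIndependent' (Matrix.toLin' D) d hd v fun i => ?_
    rw [Module.End.hasEigenvector_iff, Module.End.mem_eigenspace_iff]
    exact ⟨by simpa using hDv i, hv0 i⟩
  refine ⟨(Matrix.of v)ᵀ, ?_, ?_⟩
  · rw [← Matrix.linearIndependent_cols_iff_isUnit]
    exact hli
  · ext i j
    have := congrFun (hDv j) i
    simpa [Matrix.mul_apply, Matrix.mulVec, dotProduct, Matrix.diagonal_apply, mul_comm (d j)]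
      using this

end Triangular

section Shift

variable {K : Type*} [Field K]

/-- The `n × n` matrix whose entries are the values of a function on `ℕ × ℕ`. -/
def window (n : ℕ) (x : ℕ → ℕ → K) : Matrix (Fin n) (Fin n) K :=
  Matrix.of fun i j => x i j

variable (K) in
/-- The entries of the superdiagonal shift. -/
def shift (i j : ℕ) : K := if i + 1 = j then 1 else 0

/-- Partial sums of `x` along its diagonals. -/
def diagSum (x : ℕ → ℕ → K) : ℕ → ℕ → K
  | 0, _ => 0
  | i + 1, 0 => x i 0
  | i + 1, j + 1 => x i (j + 1) + diagSum x i j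

theorem diagSum_diag (x : ℕ → ℕ → K) (i : ℕ) :
    diagSum x (i + 1) i = ∑ k ∈ Finset.range (i + 1), x k k := by
  induction i with
  | zero => simp [diagSum]
  | succ i ih => rw [diagSum, ih, Finset.sum_range_succ _ (i + 1), add_comm]

theorem diagSum_subdiag (x : ℕ → ℕ → K) (i : ℕ) :
    diagSum x (i + 2) i = ∑ k ∈ Finset.range (i + 1), x (k + 1) k := by
  induction i with
  | zero => simp [diagSum]
  | succ i ih => rw [diagSum, ih, Finset.sum_range_succ _ (i + 1), add_comm]

theorem diagSum_eq_zero {x : ℕ → ℕ → K} {r : ℕ} (hx : ∀ i j, j + r < i → x i j = 0) (i j : ℕ)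
    (h : j + r + 1 < i) : diagSum x i j = 0 := by
  induction i generalizing j with
  | zero => rfl
  | succ i ih =>
    cases j with
    | zero => exact hx _ _ (by omega)
    | succ j => rw [diagSum, hx _ _ (by omega), ih _ (by omega), add_zero]

theorem shift_commutator_diagSum {n : ℕ} {x : ℕ → ℕ → K} (h : ∀ j < n, diagSum x n j = 0) :
    window n (shift K) * window n (diagSum x) - window n (diagSum x) * window n (shift K) =
      window n x := by
  ext ⟨i, hi⟩ ⟨j, hj⟩
  have h₁ : (window n (shift K) * window n (diagSum x)) ⟨i, hi⟩ ⟨j, hj⟩ = diagSum x (i + 1) j := by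
    rw [Matrix.mul_apply]
    by_cases hin : i + 1 < n
    · rw [Finset.sum_eq_single ⟨i + 1, hin⟩]
      · simp [window, shift]
      · intro b _ hb
        have : i + 1 ≠ b := fun h => hb (Fin.ext h.symm)
        simp [window, shift, this]
      · simp
    · obtain rfl : n = i + 1 := by omega
      rw [h j hj]
      refine Finset.sum_eq_zero fun b _ => ?_
      have : i + 1 ≠ b := by omega
      simp [window, shift, this]
  have h₂ : diagSum x (i + 1) j =
      x i j + (window n (diagSum x) * window n (shift K)) ⟨i, hi⟩ ⟨j, hj⟩ := by
    rw [Matrix.mul_apply]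
    cases j with
    | zero => simp [diagSum, window, shift]
    | succ j =>
      rw [diagSum, Finset.sum_eq_single ⟨j, by omega⟩]
      · simp [window, shift]
      · intro b _ hb
        have : b.val ≠ j := fun h => hb (Fin.ext h)
        simp [window, shift, this]
      · simp
  rw [Matrix.sub_apply, h₁, h₂]
  simp [window]

theorem exists_commutator_shift_of_hessenberg {m : ℕ} {x : ℕ → ℕ → K}
    (hx : ∀ i j, j + 1 < i → x i j = 0) (h₀ : ∑ k ∈ Finset.range (m + 1), x k k = 0)
    (h₁ : ∑ k ∈ Finset.range m, x (k + 1) k = 0) :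
    ∃ Y, window (m + 1) (shift K) * Y - Y * window (m + 1) (shift K) = window (m + 1) x := by
  refine ⟨_, shift_commutator_diagSum fun j hj => ?_⟩
  rcases lt_trichotomy (j + 1) m with h | rfl | h
  · exact diagSum_eq_zero hx _ _ (by omega)
  · rw [diagSum_subdiag, h₁]
  · obtain rfl : j = m := by omega
    rw [diagSum_diag, h₀]

/-- The function on `ℕ × ℕ` extending the entries of a matrix by zero. -/
def extendZero {n : ℕ} (X : Matrix (Fin n) (Fin n) K) (i j : ℕ) : K :=
  if h : i < n ∧ j < n then X ⟨i, h.1⟩ ⟨j, h.2⟩ else 0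

@[simp]
theorem extendZero_val {n : ℕ} (X : Matrix (Fin n) (Fin n) K) (i j : Fin n) :
    extendZero X i j = X i j := by
  simp [extendZero]

@[simp]
theorem window_extendZero {n : ℕ} (X : Matrix (Fin n) (Fin n) K) :
    window n (extendZero X) = X := by
  ext i j
  simp [window]

theorem extendZero_eq_zero {n : ℕ} {X : Matrix (Fin n) (Fin n) K} (hX : ∀ i j, j < i → X i j = 0)
    (i j : ℕ) (h : j < i) : extendZero X i j = 0 := by
  unfold extendZero
  split_ifs with hij
  · exact hX _ _ h
  · rfl

theorem sum_extendZero_diag {n : ℕ} (X : Matrix (Fin n) (Fin n) K) :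
    ∑ k ∈ Finset.range n, extendZero X k k = ∑ i, X i i := by
  rw [Finset.sum_range]
  simp

theorem exists_commutator_shift_of_upperTriangular {m : ℕ}
    {X : Matrix (Fin (m + 1)) (Fin (m + 1)) K}
    (hX : ∀ i j, j < i → X i j = 0) (h₀ : ∑ i, X i i = 0) :
    ∃ Y, window (m + 1) (shift K) * Y - Y * window (m + 1) (shift K) = X := by
  have hx := extendZero_eq_zero hX
  simpa using exists_commutator_shift_of_hessenberg (m := m) (x := extendZero X)
    (fun i j h => hx i j (by omega)) (by rw [sum_extendZero_diag, h₀])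
    (Finset.sum_eq_zero fun k _ => hx _ _ (by omega))

theorem InImage.of_upperTriangular {m : ℕ} {lam : K} {T : Matrix (Fin (m + 1)) (Fin (m + 1)) K}
    (hT : ∀ i j, j < i → T i j = 0) (hlam : 1 + lam ≠ 0) (α : Fin (m + 1) → K)
    (hα : ∀ i, α i ≠ 0) (hα₀ : ∑ i, α i = 0) (hαT : ∑ i, T i i / α i = 0)
    (h : ∀ i j, i < j → T i j = 0 ∨ α i + lam * α j ≠ 0) : InImage lam T := by
  set Q : Matrix (Fin (m + 1)) (Fin (m + 1)) K :=
    Matrix.of fun i j => T i j / (α i + lam * α j) with hQ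
  obtain ⟨B, hB⟩ := exists_commutator_shift_of_upperTriangular (X := Matrix.diagonal α)
    (fun i j hij => Matrix.diagonal_apply_ne _ hij.ne') (by simpa using hα₀)
  obtain ⟨C, hC⟩ := exists_commutator_shift_of_upperTriangular (X := Q)
    (fun i j hij => by simp [hQ, hT i j hij]) (by
      rw [← zero_div (1 + lam), ← hαT, Finset.sum_div]
      refine Finset.sum_congr rfl fun i _ => ?_
      rw [div_div, hQ, Matrix.of_apply]
      ring)
  refine ⟨window (m + 1) (shift K), B, C, ?_⟩
  rw [hB, hC]
  ext i j
  have hij : T i j = 0 ∨ α i + lam * α j ≠ 0 := by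
    rcases lt_trichotomy i j with hlt | rfl | hlt
    · exact h i j hlt
    · right
      rw [← one_add_mul]
      exact mul_ne_zero hlam (hα i)
    · exact .inl (hT i j hlt)
  simp only [Matrix.add_apply, Matrix.smul_apply, Matrix.diagonal_mul, Matrix.mul_diagonal, hQ,
    Matrix.of_apply, smul_eq_mul]
  rcases hij with h0 | h0
  · simp [h0]
  · field_simp

theorem InImage.of_upperTriangular_neg_one [CharZero K] {m : ℕ}
    {T : Matrix (Fin (m + 1)) (Fin (m + 1)) K}
    (hT : ∀ i j, j < i → T i j = 0) (h₀ : ∑ i, T i i = 0) (g : ℕ → K) (hg : ∀ i, g i ≠ 0)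
    (hgT : ∑ k ∈ Finset.range m,
      g (k + 1) / g k * ∑ l ∈ Finset.range (k + 1), extendZero T l l = 0) :
    InImage (-1 : K) T := by
  have ht := extendZero_eq_zero hT
  have hy : ∀ j < m + 1, diagSum (extendZero T) (m + 1) j = 0 := fun j hj => by
    rcases Nat.lt_succ_iff_lt_or_eq.1 hj with hj | rfl
    · exact diagSum_eq_zero (r := 0) ht _ _ (by omega)
    · rw [diagSum_diag, sum_extendZero_diag, h₀]
  have hT' := shift_commutator_diagSum hy
  rw [window_extendZero] at hT'
  set y := diagSum (extendZero T) with hydef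
  set c : K := (∑ k ∈ Finset.range (m + 1), y k k) / (m + 1 : ℕ)
  let p : ℕ → ℕ → K := fun i j => g i * shift K i j / g j
  let q : ℕ → ℕ → K := fun i j => g i * (y i j - if i = j then c else 0) / g j
  have hsum : ∑ k ∈ Finset.range (m + 1), q k k = 0 := by
    have hm : ((m + 1 : ℕ) : K) ≠ 0 := Nat.cast_ne_zero.2 (by omega)
    simp only [q, if_true, mul_div_right_comm _ _ (g _), div_self (hg _), one_mul,
      Finset.sum_sub_distrib, Finset.sum_const, Finset.card_range, nsmul_eq_mul, c]
    field_simp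
    ring
  obtain ⟨B, hB⟩ := exists_commutator_shift_of_hessenberg (m := m) (x := p)
    (fun i j h => by simp [p, shift, show i + 1 ≠ j by omega])
    (Finset.sum_eq_zero fun k _ => by simp [p, shift])
    (Finset.sum_eq_zero fun k _ => by simp [p, shift, show k + 1 + 1 ≠ k by omega])
  obtain ⟨C, hC⟩ := exists_commutator_shift_of_hessenberg (m := m) (x := q)
    (fun i j h => by
      simp [q, hydef, diagSum_eq_zero (r := 0) ht i j (by omega), show i ≠ j by omega]) hsum
    (by
      rw [← hgT]
      refine Finset.sum_congr rfl fun k _ => ?_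
      simp [q, hydef, diagSum_diag]
      ring)
  let G : Matrix (Fin (m + 1)) (Fin (m + 1)) K := Matrix.diagonal fun i => g i
  have hG : IsUnit G := by
    rw [Matrix.isUnit_iff_isUnit_det, Matrix.det_diagonal, isUnit_iff_ne_zero]
    exact Finset.prod_ne_zero_iff.2 fun i _ => hg i
  obtain ⟨u, hu⟩ := hG
  have hP : window (m + 1) p * G = G * window (m + 1) (shift K) := by
    ext i j
    simp [G, window, p, hg]
  have hQ : window (m + 1) q * G = G * (window (m + 1) y - Matrix.diagonal fun _ => c) := by
    ext i j
    simp [G, window, q, hg, Matrix.diagonal_apply, Fin.ext_iff]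
  refine InImage.of_conj (S := u⁻¹.val) (T := G * T * u⁻¹.val) u⁻¹.isUnit ?_
    ⟨window (m + 1) (shift K), B, C, ?_⟩
  · rw [← hu]
    simp [← Matrix.mul_assoc]
  · rw [hB, hC, ← hu, eq_comm, Units.eq_mul_inv_iff_mul_eq]
    rw [hu, neg_one_smul, add_mul, neg_mul, Matrix.mul_assoc, hQ, Matrix.mul_assoc, hP,
      ← Matrix.mul_assoc, hP, ← Matrix.mul_assoc, hQ, ← hT', ← Matrix.smul_one_eq_diagonal]
    noncomm_ring

end Shift

section Weights

variable {K : Type*} [Field K]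

theorem exists_ranks {p₁₂ p₂₁ p₁₃ p₃₁ p₂₃ p₃₂ : Prop} (h₁₂ : ¬(p₁₂ ∧ p₂₁)) (h₁₃ : ¬(p₁₃ ∧ p₃₁))
    (h₂₃ : ¬(p₂₃ ∧ p₃₂)) (h : ¬(p₁₂ ∧ p₂₃ ∧ p₃₁)) (h' : ¬(p₁₃ ∧ p₃₂ ∧ p₂₁)) :
    ∃ k₁ k₂ k₃ : ℕ, (k₁ ≤ k₂ → ¬p₁₂) ∧ (k₂ ≤ k₁ → ¬p₂₁) ∧ (k₁ ≤ k₃ → ¬p₁₃) ∧ (k₃ ≤ k₁ → ¬p₃₁) ∧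
      (k₂ ≤ k₃ → ¬p₂₃) ∧ (k₃ ≤ k₂ → ¬p₃₂) := by
  by_cases p₁₂ <;> by_cases p₁₃ <;> by_cases p₂₃
  · exact ⟨2, 1, 0, by grind⟩
  · exact ⟨2, 0, 1, by grind⟩
  · exact ⟨2, 1, 0, by grind⟩
  · exact ⟨1, 0, 2, by grind⟩
  · exact ⟨1, 2, 0, by grind⟩
  · by_cases p₃₂
    · exact ⟨2, 0, 1, by grind⟩
    · exact ⟨1, 2, 0, by grind⟩
  · exact ⟨0, 2, 1, by grind⟩
  · exact ⟨0, 1, 2, by grind⟩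

/-- `α` solves `∑ α i = ∑ d i / α i = 0`, and either `d` is injective or `α i + lam * α j` is
nonzero whenever `i` does not come after `j` in a suitable order. -/
def IsWeight {n : ℕ} (lam : K) (d α : Fin n → K) : Prop :=
  (∀ i, α i ≠ 0) ∧ ∑ i, α i = 0 ∧ ∑ i, d i / α i = 0 ∧
    (Function.Injective d ∨ ∃ key : Fin n → ℕ, ∀ i j, key i ≤ key j → α i + lam * α j ≠ 0)

theorem exists_isWeight_of_eq_zero [CharZero K] {m : ℕ} (hm : 1 ≤ m) {lam : K}
    (hlam : 1 + lam ≠ 0) {d : Fin (m + 2) → K} (hd : ∑ i, d i = 0) {u : Fin (m + 2)}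
    (hu : d u = 0) : ∃ α, IsWeight lam d α := by
  have hm1 : (m + 1 : K) ≠ 0 := by exact_mod_cast Nat.succ_ne_zero m
  have hm0 : (m : K) ≠ 0 := by exact_mod_cast (by omega : m ≠ 0)
  have hm2 : (m + 2 : K) ≠ 0 := by exact_mod_cast Nat.succ_ne_zero (m + 1)
  refine ⟨fun i => if i = u then -(m + 1) else 1, ?_, ?_, ?_, .inr ?_⟩
  · intro i
    dsimp only
    split_ifs
    · exact neg_ne_zero.2 hm1
    · exact one_ne_zero
  · have (i : Fin (m + 2)) : (if i = u then -(m + 1) else 1 : K) =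
        1 + if i = u then -(m + 2 : K) else 0 := by
      split_ifs <;> ring
    simp only [this, Finset.sum_add_distrib]
    simp
  · rw [← hd]
    refine Finset.sum_congr rfl fun i _ => ?_
    dsimp only
    split_ifs with h
    · simp [h, hu]
    · simp
  · have h₁ : (m + 1) * (1 + lam) ≠ 0 := mul_ne_zero hm1 hlam
    by_cases h : lam * (m + 1) = 1
    · refine ⟨fun i => if i = u then 0 else 1, fun i j => ?_⟩
      have h₂ : -(m + 1 : K) + lam ≠ 0 := fun h' => mul_ne_zero hm0 hm2 (by
        linear_combination h - (m + 1) * h')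
      by_cases hi : i = u <;> by_cases hj : j = u
      · simpa [hi, hj] using fun h' => h₁ (by linear_combination -h')
      · simpa [hi, hj] using h₂
      · simp [hi, hj]
      · simpa [hi, hj] using hlam
    · refine ⟨fun i => if i = u then 1 else 0, fun i j => ?_⟩
      by_cases hi : i = u <;> by_cases hj : j = u
      · simpa [hi, hj] using fun h' => h₁ (by linear_combination -h')
      · simp [hi, hj]
      · simpa [hi, hj] using fun h' => h (by linear_combination -h')
      · simpa [hi, hj] using hlam

theorem exists_add_eq_zero_and_div_add_div_eq_zero [IsAlgClosed K] [CharZero K] {m u v : K}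
    (hm : m ≠ 0) (hu : u ≠ 0) (hv : v ≠ 0) :
    ∃ x y : K, x ≠ 0 ∧ y ≠ 0 ∧ m + x + y = 0 ∧ -(u + v) + u / x + v / y = 0 := by
  have hx : ∃ x : K, (u + v) * x ^ 2 + (m * (u + v) - u + v) * x - u * m = 0 := by
    by_cases huv : u + v = 0
    · refine ⟨-m / 2, ?_⟩
      linear_combination (m ^ 2 / 4 - m ^ 2 / 2 - m / 2) * huv
    · obtain ⟨z, hz⟩ := IsAlgClosed.exists_pow_nat_eq
        ((m * (u + v) - u + v) ^ 2 + 4 * (u + v) * (u * m)) (n := 2) (by norm_num)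
      refine ⟨(z - (m * (u + v) - u + v)) / (2 * (u + v)), ?_⟩
      field_simp
      linear_combination hz
  obtain ⟨x, hx⟩ := hx
  have hx0 : x ≠ 0 := by
    rintro rfl
    exact mul_ne_zero hu hm (by linear_combination -hx)
  have hy0 : -(m + x) ≠ 0 := by
    intro hy
    obtain rfl : x = -m := by linear_combination -hy
    exact mul_ne_zero hv hm (by linear_combination -hx)
  refine ⟨x, -(m + x), hx0, hy0, by ring, ?_⟩
  have hy0' : m + x ≠ 0 := fun h => hy0 (by rw [h, neg_zero])
  rw [div_neg]
  field_simp
  linear_combination -hx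

theorem sum_ite_pair {ι : Type*} [Fintype ι] [DecidableEq ι] {u v : ι} (huv : u ≠ v) (a b : K) :
    ∑ i, (if i = u then a else if i = v then b else 0) = a + b := by
  rw [Finset.sum_eq_add u v huv]
  · simp [huv.symm]
  · intro c _ hc
    simp [hc.1, hc.2]
  · simp
  · simp

theorem injective_of_sum_eq_zero {d : Fin 3 → K} (hd : ∑ i, d i = 0) {u v : Fin 3} (huv : u ≠ v)
    (h₁ : d u ≠ d v) (h₂ : d u ≠ -(d u + d v)) (h₃ : d v ≠ -(d u + d v)) :
    Function.Injective d := by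
  rw [Fin.sum_univ_three] at hd
  intro i j hij
  fin_cases u <;> fin_cases v <;> fin_cases i <;> fin_cases j <;> simp_all <;> grind

theorem ne_of_cube_root [CharZero K] {lam u v : K} (hlam : 1 + lam ≠ 0)
    (h : lam ^ 2 - lam + 1 = 0) (hv : v ≠ 0) (hu : u * (1 + lam) = v * (lam - 2)) :
    u ≠ v ∧ u ≠ -(u + v) ∧ v ≠ -(u + v) := by
  obtain rfl : u = (lam - 1) * v := mul_right_cancel₀ hlam (by linear_combination hu - v * h)
  refine ⟨fun h' => ?_, fun h' => ?_, fun h' => ?_⟩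
  · obtain rfl : lam = 2 := by
      have : (lam - 2) * v = 0 := by linear_combination h'
      linear_combination (mul_eq_zero.1 this).resolve_right hv
    norm_num at h
  · have : (2 * lam - 1) * v = 0 := by linear_combination h'
    have := (mul_eq_zero.1 this).resolve_right hv
    have h3 : (3 : K) = 0 := by linear_combination 4 * h - (2 * lam - 1) * this
    norm_num at h3
  · exact mul_ne_zero hlam hv (by linear_combination h')

theorem exists_isWeight_of_pair [IsAlgClosed K] [CharZero K] {m : ℕ} (hm : 1 ≤ m) {lam : K}
    (hlam : 1 + lam ≠ 0) {d : Fin (m + 2) → K} (hd : ∑ i, d i = 0) {u v : Fin (m + 2)}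
    (huv : u ≠ v) (hu : d u ≠ 0) (hv : d v ≠ 0) (h₁ : 2 * d u * (1 - m) ≠ m * d v)
    (h₂ : 2 * d v * (1 - m) ≠ m * d u) : ∃ α, IsWeight lam d α := by
  have hm0 : (m : K) ≠ 0 := by exact_mod_cast (by omega : m ≠ 0)
  obtain ⟨x, y, hx, hy, hxy, hduv⟩ := exists_add_eq_zero_and_div_add_div_eq_zero hm0 hu hv
  refine ⟨fun i => if i = u then x else if i = v then y else 1, ?_, ?_, ?_, ?_⟩
  · intro i
    dsimp only
    split_ifs <;> simp [hx, hy]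
  · have (i : Fin (m + 2)) : (if i = u then x else if i = v then y else 1) =
        1 + if i = u then x - 1 else if i = v then y - 1 else 0 := by
      split_ifs <;> ring
    simp only [this, Finset.sum_add_distrib, sum_ite_pair huv]
    simp
    linear_combination hxy
  · have (i : Fin (m + 2)) : d i / (if i = u then x else if i = v then y else 1) =
        d i + if i = u then d u / x - d u else if i = v then d v / y - d v else 0 := by
      split_ifs with h h' <;> simp [*]
    simp only [this, Finset.sum_add_distrib, sum_ite_pair huv, hd]
    linear_combination hduv
  have key {a b : K} (h : a + lam * b = 0) (h' : b + lam * a = 0) (ha : a ≠ 0) :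
      lam = 1 ∧ b = -a := by
    have : (1 + lam) * (1 - lam) * a = 0 := by linear_combination h - lam * h'
    obtain rfl : lam = 1 := by
      have := (mul_eq_zero.1 this).resolve_right ha
      linear_combination -(mul_eq_zero.1 this).resolve_left hlam
    exact ⟨rfl, by linear_combination h⟩
  by_cases hcyc : (1 + lam * x = 0 ∧ x + lam * y = 0 ∧ y + lam * 1 = 0) ∨
      (1 + lam * y = 0 ∧ y + lam * x = 0 ∧ x + lam * 1 = 0)
  · left
    have hl (h : lam ^ 3 + 1 = 0) : lam ^ 2 - lam + 1 = 0 :=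
      (mul_eq_zero.1 (by linear_combination h :
        (1 + lam) * (lam ^ 2 - lam + 1) = 0)).resolve_left hlam
    have hm1 (h : lam ^ 2 - lam + 1 = 0) (h' : m + (lam ^ 2 - lam) = 0) : m = 1 := by
      have : (m : K) = 1 := by linear_combination h' - h
      exact_mod_cast this
    rcases hcyc with ⟨e₁, e₂, e₃⟩ | ⟨e₁, e₂, e₃⟩
    · obtain rfl : y = -lam := by linear_combination e₃
      obtain rfl : x = lam ^ 2 := by linear_combination e₂
      have h := hl (by linear_combination e₁)
      obtain rfl := hm1 h (by linear_combination hxy)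
      have i₁ : d u / lam ^ 2 = -lam * d u := by
        rw [div_eq_iff hx]
        linear_combination d u * e₁
      have i₂ : d v / -lam = lam ^ 2 * d v := by
        rw [div_eq_iff hy]
        linear_combination d v * e₁
      rw [i₁, i₂] at hduv
      obtain ⟨n₁, n₂, n₃⟩ := ne_of_cube_root (u := d u) hlam h hv (by
        linear_combination -hduv + d v * h)
      exact injective_of_sum_eq_zero hd huv n₁ n₂ n₃
    · obtain rfl : x = -lam := by linear_combination e₃
      obtain rfl : y = lam ^ 2 := by linear_combination e₂
      have h := hl (by linear_combination e₁)
      obtain rfl := hm1 h (by linear_combination hxy)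
      have i₁ : d v / lam ^ 2 = -lam * d v := by
        rw [div_eq_iff hy]
        linear_combination d v * e₁
      have i₂ : d u / -lam = lam ^ 2 * d u := by
        rw [div_eq_iff hx]
        linear_combination d u * e₁
      rw [i₁, i₂] at hduv
      obtain ⟨n₁, n₂, n₃⟩ := ne_of_cube_root (u := d v) hlam h hu (by
        linear_combination -hduv + d u * h)
      exact injective_of_sum_eq_zero hd huv.symm n₁ n₂ n₃
  · right
    obtain ⟨k₁, k₂, k₃, h₁₂, h₂₁, h₁₃, h₃₁, h₂₃, h₃₂⟩ := exists_ranks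
      (p₁₂ := 1 + lam * x = 0) (p₂₁ := x + lam * 1 = 0) (p₁₃ := 1 + lam * y = 0)
      (p₃₁ := y + lam * 1 = 0) (p₂₃ := x + lam * y = 0) (p₃₂ := y + lam * x = 0)
      (fun h => by
        obtain ⟨-, rfl⟩ := key h.1 h.2 one_ne_zero
        obtain rfl : y = 1 - m := by linear_combination hxy
        apply h₁
        field_simp at hduv
        linear_combination -hduv)
      (fun h => by
        obtain ⟨-, rfl⟩ := key h.1 h.2 one_ne_zero
        obtain rfl : x = 1 - m := by linear_combination hxy
        apply h₂
        field_simp at hduv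
        linear_combination -hduv)
      (fun h => by
        obtain ⟨-, rfl⟩ := key h.1 h.2 hx
        exact hm0 (by linear_combination hxy))
      (fun h => hcyc (.inl h)) (fun h => hcyc (.inr h))
    refine ⟨fun i => if i = u then k₂ else if i = v then k₃ else k₁, fun i j => ?_⟩
    have hself {a : K} (ha : a ≠ 0) : a + lam * a ≠ 0 := by
      rw [← one_add_mul]
      exact mul_ne_zero hlam ha
    dsimp only
    split_ifs
    exacts [fun _ => hself hx, h₂₃, h₂₁, h₃₂, fun _ => hself hy, h₃₁, h₁₂, h₁₃,
      fun _ => hself one_ne_zero]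

theorem exists_isWeight [IsAlgClosed K] [CharZero K] {m : ℕ} (hm : 1 ≤ m) {lam : K}
    (hlam : 1 + lam ≠ 0) {d : Fin (m + 2) → K} (hd : ∑ i, d i = 0) : ∃ α, IsWeight lam d α := by
  by_cases h0 : ∃ u, d u = 0
  · obtain ⟨u, hu⟩ := h0
    exact exists_isWeight_of_eq_zero hm hlam hd hu
  push Not at h0
  have h2 : 2 < m + 2 := by omega
  by_contra H
  have hp {u v : Fin (m + 2)} (huv : u ≠ v) :
      2 * d u * (1 - m) = m * d v ∨ 2 * d v * (1 - m) = m * d u := by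
    by_contra! h
    exact H (exists_isWeight_of_pair hm hlam hd huv (h0 u) (h0 v) h.1 h.2)
  have hm0 : (m : K) ≠ 0 := by exact_mod_cast (by omega : m ≠ 0)
  obtain ⟨c, hc⟩ : ∃ c : K, c * m = 2 * (1 - m) := ⟨2 * (1 - m) / m, div_mul_cancel₀ _ hm0⟩
  have hc3 : c ^ 3 ≠ 1 := by
    intro h
    obtain ⟨k, rfl⟩ : ∃ k, m = k + 1 := ⟨m - 1, by omega⟩
    push_cast at hc
    obtain hc : c * (k + 1) = -2 * k := by linear_combination hc
    have : ((k + 1) ^ 3 + 8 * k ^ 3 : K) = 0 := by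
      linear_combination (-(k + 1) ^ 3 : K) * h +
        ((c * (k + 1)) ^ 2 + c * (k + 1) * (-2 * k) + (-2 * k) ^ 2) * hc
    have : (k + 1) ^ 3 + 8 * k ^ 3 = 0 := by exact_mod_cast this
    exact (by positivity : 0 < (k + 1) ^ 3 + 8 * k ^ 3).ne' this
  have hc1 : c ≠ 1 := by
    rintro rfl
    exact hc3 (one_pow 3)
  have hq {u v : Fin (m + 2)} (huv : u ≠ v) : d v = c * d u ∨ d u = c * d v := by
    refine (hp huv).imp (fun h => ?_) fun h => ?_ <;> refine mul_left_cancel₀ hm0 ?_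
    · linear_combination -h - d u * hc
    · linear_combination -h - d v * hc
  have q₁ := hq (u := ⟨0, by omega⟩) (v := ⟨1, by omega⟩) (by simp)
  have q₂ := hq (u := ⟨1, by omega⟩) (v := ⟨2, by omega⟩) (by simp)
  have q₃ := hq (u := ⟨0, by omega⟩) (v := ⟨2, by omega⟩) (by simp)
  have r₁ := h0 ⟨0, by omega⟩
  have r₂ := h0 ⟨1, by omega⟩
  have r₃ := h0 ⟨2, by omega⟩
  generalize d ⟨0, _⟩ = a at *
  generalize d ⟨1, _⟩ = b at *
  generalize d ⟨2, _⟩ = e at *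
  clear hp hq h0 hc H
  grind

end Weights

section Main

variable {K : Type*} [Field K]

theorem exists_map_univ_eq {α : Type*} {n : ℕ} (s : Multiset α) (hs : s.card = n) :
    ∃ d : Fin n → α, Finset.univ.val.map d = s := by
  subst hs
  induction s using Quotient.inductionOn with
  | h l => exact ⟨l.get, (Fin.univ_val_map l.get).trans (congrArg _ (List.ofFn_get l))⟩

open Polynomial in
theorem exists_charpoly_eq_prod [IsAlgClosed K] {n : ℕ} (D : Matrix (Fin n) (Fin n) K) :
    ∃ d : Fin n → K, D.charpoly = ∏ i, (X - C (d i)) ∧ ∑ i, d i = D.trace := by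
  have hs := IsAlgClosed.splits D.charpoly
  obtain ⟨d, hd⟩ := exists_map_univ_eq D.charpoly.roots
    (by rw [← hs.natDegree_eq_card_roots, D.charpoly_natDegree_eq_dim, Fintype.card_fin])
  refine ⟨d, ?_, ?_⟩
  · conv_lhs => rw [hs.eq_prod_roots_of_monic D.charpoly_monic, ← hd, Multiset.map_map]
    rfl
  · rw [Matrix.trace_eq_sum_roots_charpoly, ← hd]
    rfl

open Polynomial in
theorem inImage_of_ne_neg_one [IsAlgClosed K] [CharZero K] {m : ℕ} (hm : 1 ≤ m) {lam : K}
    (hlam : 1 + lam ≠ 0) {D : Matrix (Fin (m + 2)) (Fin (m + 2)) K} (hD : D.trace = 0) :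
    InImage lam D := by
  obtain ⟨d, hd, hsum⟩ := exists_charpoly_eq_prod D
  rw [hD] at hsum
  obtain ⟨α, hα, hα₀, hαd, hinj | ⟨key, hkey⟩⟩ := exists_isWeight hm hlam hsum
  · obtain ⟨S, hS, hDS⟩ := exists_diagonal D d hd hinj
    refine .of_conj hS hDS (.of_upperTriangular (fun i j h => ?_) hlam α hα hα₀ ?_ fun i j h => ?_)
    · exact Matrix.diagonal_apply_ne _ h.ne'
    · simpa using hαd
    · exact .inl (Matrix.diagonal_apply_ne _ h.ne)
  · let σ := Tuple.sort key
    obtain ⟨S, T, hS, hDS, hT, hTd⟩ := exists_upperTriangular D (d ∘ σ)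
      (by rw [hd]; exact (Equiv.prod_comp σ fun i => X - C (d i)).symm)
    refine .of_conj hS hDS (.of_upperTriangular hT hlam (α ∘ σ) (fun i => hα _) ?_ ?_
      fun i j h => .inr (hkey _ _ (Tuple.monotone_sort key h.le)))
    · rw [← hα₀]
      exact Equiv.sum_comp σ α
    · simp only [hTd]
      rw [← hαd]
      exact Equiv.sum_comp σ fun i => d i / α i

theorem exists_perm_of_sum_eq_zero [CharZero K] {m : ℕ} (hm : 1 ≤ m) {d : Fin (m + 2) → K}
    (hd : ∑ i, d i = 0) (hd0 : d ≠ 0) :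
    ∃ σ : Equiv.Perm (Fin (m + 2)), d (σ 0) ≠ 0 ∧ d (σ 0) + d (σ 1) ≠ 0 := by
  obtain ⟨u, hu⟩ := Function.ne_iff.1 hd0
  obtain ⟨v, hvu, hv⟩ : ∃ v, v ≠ u ∧ d u + d v ≠ 0 := by
    by_contra! H
    have : ∀ i, d i = -d u + if i = u then 2 * d u else 0 := fun i => by
      split_ifs with h
      · rw [h]; ring
      · linear_combination H i h
    have h0 : ∑ i, (-d u + if i = u then 2 * d u else 0) = 0 :=
      (Finset.sum_congr rfl fun i _ => (this i).symm).trans hd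
    rw [Finset.sum_add_distrib] at h0
    simp at h0
    have hm0 : (m : K) ≠ 0 := by exact_mod_cast (by omega : m ≠ 0)
    exact mul_ne_zero hm0 hu (by linear_combination -h0)
  refine ⟨(Equiv.swap 1 (Equiv.swap 0 u v)).trans (Equiv.swap 0 u), ?_⟩
  have h1 : Equiv.swap 0 u v ≠ 0 := fun h => hvu (by
    rw [Equiv.swap_apply_eq_iff] at h
    simpa using h)
  have e0 : Equiv.swap 1 (Equiv.swap 0 u v) 0 = (0 : Fin (m + 2)) :=
    Equiv.swap_apply_of_ne_of_ne (by simp) h1.symm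
  simp only [Equiv.trans_apply, e0, Equiv.swap_apply_left, Equiv.swap_apply_self]
  exact ⟨hu, by simpa using hv⟩

open Polynomial in
theorem inImage_neg_one [IsAlgClosed K] [CharZero K] {m : ℕ} (hm : 1 ≤ m)
    {D : Matrix (Fin (m + 2)) (Fin (m + 2)) K} (hD : D.trace = 0) : InImage (-1 : K) D := by
  obtain ⟨d, hd, hsum⟩ := exists_charpoly_eq_prod D
  rw [hD] at hsum
  by_cases hd0 : d = 0
  · obtain ⟨S, T, hS, hDS, hT, hTd⟩ := exists_upperTriangular D d hd
    refine .of_conj hS hDS (.of_upperTriangular_neg_one hT (by simp [hTd, hsum]) (fun _ => 1)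
      (fun _ => one_ne_zero) (Finset.sum_eq_zero fun k hk => ?_))
    rw [Finset.sum_eq_zero, mul_zero]
    intro l hl
    rw [Finset.mem_range] at hk hl
    simpa [hd0, hTd] using extendZero_val T ⟨l, by omega⟩ ⟨l, by omega⟩
  · obtain ⟨σ, hσ₀, hσ₁⟩ := exists_perm_of_sum_eq_zero hm hsum hd0
    obtain ⟨S, T, hS, hDS, hT, hTd⟩ := exists_upperTriangular D (d ∘ σ)
      (by rw [hd]; exact (Equiv.prod_comp σ fun i => X - C (d i)).symm)
    obtain ⟨k, rfl⟩ : ∃ k, m = k + 1 := ⟨m - 1, by omega⟩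
    set s : ℕ → K := fun i => ∑ l ∈ Finset.range (i + 1), extendZero T l l with hs
    have ht₀ : extendZero T 0 0 = d (σ 0) := by
      rw [← Function.comp_apply (f := d), ← hTd]
      exact extendZero_val T 0 0
    have ht₁ : extendZero T 1 1 = d (σ 1) := by
      rw [← Function.comp_apply (f := d), ← hTd]
      exact extendZero_val T 1 1
    have hs₀ : s 0 ≠ 0 := by simpa [hs, ht₀] using hσ₀
    have hs₁ : s 1 ≠ 0 := by simpa [hs, ht₀, ht₁, Finset.sum_range_succ] using hσ₁
    set R := ∑ i ∈ Finset.range k, s (i + 2)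
    obtain ⟨a, ha, hR⟩ : ∃ a : K, a ≠ 0 ∧ a * s 0 + R ≠ 0 := by
      by_cases h : s 0 + R = 0
      · exact ⟨2, two_ne_zero, fun h' => hs₀ (by linear_combination h' - h)⟩
      · exact ⟨1, one_ne_zero, by rwa [one_mul]⟩
    set b := -(a * s 0 + R) / s 1
    have hb : b ≠ 0 := div_ne_zero (neg_ne_zero.2 hR) hs₁
    let g : ℕ → K
      | 0 => 1
      | 1 => a
      | _ + 2 => a * b
    have hg : ∀ i, g i ≠ 0
      | 0 => one_ne_zero
      | 1 => ha
      | _ + 2 => mul_ne_zero ha hb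
    refine .of_conj hS hDS (.of_upperTriangular_neg_one hT ?_ g hg ?_)
    · simp only [hTd]
      rw [← hsum]
      exact Equiv.sum_comp σ d
    · change ∑ i ∈ Finset.range (k + 2), g (i + 1) / g i * s i = 0
      rw [Finset.sum_range_succ', Finset.sum_range_succ']
      have : ∀ i, g (i + 1 + 1 + 1) / g (i + 1 + 1) * s (i + 1 + 1) = s (i + 2) := fun i => by
        have hgi : g (i + 1 + 1) ≠ 0 := hg (i + 1 + 1)
        rw [show g (i + 1 + 1 + 1) = g (i + 1 + 1) from rfl, div_self hgi, one_mul]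
      simp only [this]
      have hbs : b * s 1 = -(a * s 0 + R) := div_mul_cancel₀ _ hs₁
      change R + a * b / a * s 1 + a / 1 * s 0 = 0
      rw [mul_div_cancel_left₀ _ ha, hbs]
      ring

end Main

theorem stmt_6 (K : Type*) [Field K] [IsAlgClosed K] [CharZero K] (n : ℕ) (hn : 3 ≤ n)
    (lam : K)
    (D : Matrix (Fin n) (Fin n) K) (hD : Matrix.trace D = 0) :
    D ∈ {X : Matrix (Fin n) (Fin n) K |
          ∃ A B C : Matrix (Fin n) (Fin n) K,
            X = (A * B - B * A) * (A * C - C * A) +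
                  lam • ((A * C - C * A) * (A * B - B * A))} := by
  obtain ⟨m, rfl⟩ : ∃ m, n = m + 2 := ⟨n - 2, by omega⟩
  have hm : 1 ≤ m := by omega
  by_cases hlam : 1 + lam = 0
  · obtain rfl : lam = -1 := by linear_combination hlam
    exact inImage_neg_one hm hD
  · exact inImage_of_ne_neg_one hm hlam hD
end

section
/- Let K be an algebraically closed field of characteristic zero and n ≥ 3. Then for every nonzero multilinear polynomial f(x₁,x₂,x₃,x₄) ∈ K⟨x₁,x₂,x₃,x₄⟩, the image f(M_n(K)) contains all trace zero matrices sl_n(K). -/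
open Matrix

/-- Evaluation of the multilinear polynomial `∑_{σ ∈ S₄} α_σ x_{σ(1)} x_{σ(2)} x_{σ(3)} x_{σ(4)}`. -/
def mlEval {K : Type*} [Field K] {R : Type*} [Ring R] [Algebra K R] {m : ℕ}
    (α : Equiv.Perm (Fin m) → K) (a : Fin m → R) : R :=
  ∑ σ : Equiv.Perm (Fin m), α σ • (List.ofFn fun i => a (σ i)).prod

/-- The `n × n` corner of an infinite array. -/
def corner {K : Type*} (n : ℕ) (F : ℕ → ℕ → K) : Matrix (Fin n) (Fin n) K :=
  Matrix.of fun i j => F i j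

theorem exists_eq_corner {K : Type*} [Zero K] {n : ℕ} (T : Matrix (Fin n) (Fin n) K) :
    ∃ F : ℕ → ℕ → K, T = corner n F := by
  refine ⟨fun i j => if h : i < n ∧ j < n then T ⟨i, h.1⟩ ⟨j, h.2⟩ else 0, ?_⟩
  ext i j
  simp [corner]

theorem trace_corner {K : Type*} [AddCommMonoid K] (n : ℕ) (F : ℕ → ℕ → K) :
    (corner n F).trace = ∑ k ∈ Finset.range n, F k k := by
  simp [Matrix.trace, corner, Finset.sum_range]

/-- The array with diagonal `d`, superdiagonal `ν` and zeros elsewhere. -/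
def bidiag {K : Type*} [Zero K] (d ν : ℕ → K) (i j : ℕ) : K :=
  if j = i then d i else if j = i + 1 then ν i else 0

section
variable {K : Type*} [Field K] {n : ℕ}

theorem lie_bidiag_corner {d ν : ℕ → K} {Z R : ℕ → ℕ → K}
    (hrec : ∀ i j, ν i * Z (i + 1) j =
      R i j - (d i - d j) * Z i j + if j = 0 then 0 else Z i (j - 1) * ν (j - 1))
    (hZ : ∀ j < n, Z n j = 0) :
    ⁅corner n (bidiag d ν), corner n Z⁆ = corner n R := by
  ext i j
  obtain ⟨i, hi⟩ := i
  obtain ⟨j, hj⟩ := j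
  have h1 : (corner n (bidiag d ν) * corner n Z) ⟨i, hi⟩ ⟨j, hj⟩ =
      d i * Z i j + ν i * Z (i + 1) j := by
    simp only [Matrix.mul_apply, corner, Matrix.of_apply]
    rw [← Finset.sum_range (fun k => bidiag d ν i k * Z k j)]
    have h : ∀ k, bidiag d ν i k * Z k j =
        (if k = i then d i * Z i j else 0) + (if k = i + 1 then ν i * Z (i + 1) j else 0) := by
      intro k
      unfold bidiag
      split_ifs <;> first | omega | (subst_vars; simp)
    simp only [h, Finset.sum_add_distrib, Finset.sum_ite_eq', Finset.mem_range, hi, if_true]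
    split_ifs with h'
    · rfl
    · have : i + 1 = n := by omega
      rw [this, hZ j hj]; simp
  have h2 : (corner n Z * corner n (bidiag d ν)) ⟨i, hi⟩ ⟨j, hj⟩ =
      Z i j * d j + if j = 0 then 0 else Z i (j - 1) * ν (j - 1) := by
    simp only [Matrix.mul_apply, corner, Matrix.of_apply]
    rw [← Finset.sum_range (fun k => Z i k * bidiag d ν k j)]
    have h : ∀ k, Z i k * bidiag d ν k j =
        (if k = j then Z i j * d j else 0) +
          (if k = j - 1 then (if j = 0 then 0 else Z i (j - 1) * ν (j - 1)) else 0) := by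
      intro k
      unfold bidiag
      split_ifs <;> first | omega | (subst_vars; simp)
    have h' : j - 1 < n := by omega
    simp only [h, Finset.sum_add_distrib, Finset.sum_ite_eq', Finset.mem_range, hj, h', if_true]
  rw [Ring.lie_def, Matrix.sub_apply, h1, h2]
  have := hrec i j
  simp only [corner, Matrix.of_apply]
  linear_combination this

theorem exists_rows (d : ℕ → K) {ν : ℕ → K} (hν : ∀ i, ν i ≠ 0) (R : ℕ → ℕ → K) :
    ∃ Z : ℕ → ℕ → K, (∀ j, Z 0 j = 0) ∧ ∀ i j, ν i * Z (i + 1) j =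
      R i j - (d i - d j) * Z i j + if j = 0 then 0 else Z i (j - 1) * ν (j - 1) := by
  refine ⟨fun i => Nat.rec (fun _ => 0) (fun i z j => (R i j - (d i - d j) * z j +
    if j = 0 then 0 else z (j - 1) * ν (j - 1)) / ν i) i, fun _ => rfl, fun i j => ?_⟩
  dsimp only
  rw [mul_div_cancel₀ _ (hν i)]

theorem exists_lie_bidiag_eq_aux {d ν : ℕ → K} {R : ℕ → ℕ → K} (hν : ∀ i, ν i ≠ 0)
    (hR : ∀ i j, i < n → j + 1 < i → R i j = 0) (htr : ∑ k ∈ Finset.range n, R k k = 0)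
    (hd : ∀ i, i + 1 < n → (d (i + 1) - d i) * ∑ k ∈ Finset.range (i + 1), R k k =
      ν i * R (i + 1) i) :
    ∃ Z : ℕ → ℕ → K, ⁅corner n (bidiag d ν), corner n Z⁆ = corner n R ∧
      (∀ i j, i ≤ n → j + 1 < i → Z i j = 0) ∧
      (∀ i < n, ν i * Z (i + 1) i = ∑ k ∈ Finset.range (i + 1), R k k) ∧
      ∀ i j, ν i * Z (i + 1) j =
        R i j - (d i - d j) * Z i j + if j = 0 then 0 else Z i (j - 1) * ν (j - 1) := by
  obtain ⟨Z, h0, hrec⟩ := exists_rows d hν R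
  have key : ∀ i, i ≤ n → (∀ j, j + 1 < i → Z i j = 0) ∧
      ∀ j, j + 1 = i → ν j * Z i j = ∑ k ∈ Finset.range i, R k k := by
    intro i
    induction i with
    | zero => intro _; simp
    | succ i ih =>
      intro hi
      obtain ⟨ih1, ih2⟩ := ih (by omega)
      constructor
      · intro j hj
        apply mul_left_cancel₀ (hν i)
        rw [hrec, mul_zero]
        have hlast : (if j = 0 then 0 else Z i (j - 1) * ν (j - 1)) = 0 := by
          split_ifs with h
          · rfl
          · rw [ih1 _ (by omega), zero_mul]
        rw [hlast, add_zero]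
        rcases Nat.lt_or_ge (j + 1) i with h | h
        · rw [ih1 j h, hR i j (by omega) h]; simp
        · obtain rfl : i = j + 1 := by omega
          apply mul_left_cancel₀ (hν j)
          have e1 := ih2 j rfl
          have e2 := hd j (by omega)
          rw [← e1] at e2
          linear_combination -e2
      · intro j hj
        obtain rfl : j = i := by omega
        rw [hrec, sub_self, zero_mul, sub_zero, Finset.sum_range_succ, add_comm]
        congr 1
        split_ifs with h
        · simp [h]
        · rw [← ih2 (j - 1) (by omega), mul_comm]
  refine ⟨Z, lie_bidiag_corner hrec fun j hj => ?_, fun i j hi => (key i hi).1 j,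
    fun i hi => (key (i + 1) hi).2 i rfl, hrec⟩
  rcases Nat.lt_or_ge (j + 1) n with h | h
  · exact (key n le_rfl).1 j h
  · have := (key n le_rfl).2 j (by omega)
    rw [htr] at this
    exact (mul_eq_zero.1 this).resolve_left (hν j)

theorem exists_lie_bidiag_eq [CharZero K] (hn : n ≠ 0) {d ν : ℕ → K} {R : ℕ → ℕ → K}
    (hν : ∀ i, ν i ≠ 0) (hR : ∀ i j, i < n → j + 1 < i → R i j = 0)
    (htr : ∑ k ∈ Finset.range n, R k k = 0)
    (hd : ∀ i, i + 1 < n → (d (i + 1) - d i) * ∑ k ∈ Finset.range (i + 1), R k k =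
      ν i * R (i + 1) i) :
    ∃ Z : ℕ → ℕ → K, ⁅corner n (bidiag d ν), corner n Z⁆ = corner n R ∧
      ∑ k ∈ Finset.range n, Z k k = 0 ∧ (∀ i j, i < n → j + 1 < i → Z i j = 0) ∧
      (∀ i, i + 1 < n → ν i * Z (i + 1) i = ∑ k ∈ Finset.range (i + 1), R k k) ∧
      ∀ i, ν i * (Z (i + 1) (i + 1) - Z i i) =
        R i (i + 1) - (d i - d (i + 1)) * Z i (i + 1) := by
  obtain ⟨Z, h1, h2, h3, h4⟩ := exists_lie_bidiag_eq_aux hν hR htr hd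
  let c : K := -(∑ k ∈ Finset.range n, Z k k) / n
  refine ⟨fun i j => Z i j + if i = j then c else 0, ?_, ?_, fun i j hi hij => ?_,
    fun i hi => ?_, fun i => ?_⟩
  · have : corner n (fun i j => Z i j + if i = j then c else 0) = corner n Z + c • 1 := by
      ext i j
      simp [corner, Matrix.one_apply, Fin.ext_iff]
    rw [this, ← h1]
    simp [Ring.lie_def, mul_add, add_mul]
  · have : (n : K) ≠ 0 := Nat.cast_ne_zero.2 hn
    simp only [if_true, Finset.sum_add_distrib, Finset.sum_const, Finset.card_range, nsmul_eq_mul]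
    simp only [c]
    field_simp
    ring
  · simp [h2 i j hi.le hij, show i ≠ j by omega]
  · simp [h3 i (by omega)]
  · have := h4 i (i + 1)
    simp only [Nat.add_eq_zero_iff, one_ne_zero, and_false, if_false, Nat.add_sub_cancel] at this
    simp only [if_true, left_eq_add, one_ne_zero, if_false]
    linear_combination this

theorem exists_lie_superdiag_eq {x : ℕ → K} {R : ℕ → ℕ → K} (hx : ∀ i, x i ≠ 0)
    (hR : ∀ i j, i < n → j + 1 < i → R i j = 0) (htr : ∑ k ∈ Finset.range n, R k k = 0)
    (hsub : ∑ k ∈ Finset.range (n - 1), x k * R (k + 1) k = 0) :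
    ∃ Z : ℕ → ℕ → K, ⁅corner n (bidiag 0 x), corner n Z⁆ = corner n R := by
  obtain ⟨Z, h0, hrec⟩ := exists_rows (0 : ℕ → K) hx R
  have key : ∀ i, i ≤ n → (∀ j, j + 2 < i → Z i j = 0) ∧
      (∀ j, j + 1 = i → x j * Z i j = ∑ k ∈ Finset.range i, R k k) ∧
      ∀ j, j + 2 = i → x j * x (j + 1) * Z i j =
        ∑ k ∈ Finset.range (i - 1), x k * R (k + 1) k := by
    intro i
    induction i with
    | zero => simp
    | succ i ih =>
      intro hi
      obtain ⟨ih1, ih2, ih3⟩ := ih (by omega)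
      simp only [Pi.zero_apply, sub_self, zero_mul, sub_zero] at hrec
      refine ⟨fun j hj => ?_, fun j hj => ?_, fun j hj => ?_⟩
      · apply mul_left_cancel₀ (hx i)
        rw [hrec, mul_zero, hR i j (by omega) (by omega), zero_add]
        split_ifs with h
        · rfl
        · rw [ih1 _ (by omega), zero_mul]
      · obtain rfl : j = i := by omega
        rw [hrec, Finset.sum_range_succ, add_comm]
        congr 1
        split_ifs with h
        · simp [h]
        · rw [← ih2 (j - 1) (by omega), mul_comm]
      · obtain rfl : i = j + 1 := by omega
        rw [mul_assoc, hrec, mul_add, Nat.add_sub_cancel, Finset.sum_range_succ, add_comm]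
        congr 1
        split_ifs with h
        · simp [h]
        · have := ih3 (j - 1) (by omega)
          rw [Nat.add_sub_cancel, Nat.sub_add_cancel (by omega)] at this
          rw [← this]; ring
  refine ⟨Z, lie_bidiag_corner hrec fun j hj => ?_⟩
  obtain ⟨k1, k2, k3⟩ := key n le_rfl
  rcases lt_trichotomy (j + 2) n with h | h | h
  · exact k1 j h
  · have := k3 j h
    rw [hsub] at this
    exact (mul_eq_zero.1 this).resolve_left (mul_ne_zero (hx _) (hx _))
  · have := k2 j (by omega)
    rw [htr] at this
    exact (mul_eq_zero.1 this).resolve_left (hx j)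
end

section
variable {K : Type*} [Field K] {n : ℕ}

theorem IsConj.exists_algEquiv {R : Type*} [Ring R] [Algebra K R] {A B : R} (h : IsConj A B) :
    ∃ φ : R ≃ₐ[K] R, φ A = B := by
  obtain ⟨c, hc⟩ := h
  refine ⟨MulSemiringAction.toAlgEquiv K R (ConjAct.toConjAct c), ?_⟩
  rw [MulSemiringAction.toAlgEquiv_apply, ConjAct.units_smul_def, ConjAct.ofConjAct_toConjAct,
    hc.eq, mul_assoc, Units.mul_inv, mul_one]

theorem IsConj.trace_eq {A B : Matrix (Fin n) (Fin n) K} (h : IsConj A B) :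
    A.trace = B.trace := by
  obtain ⟨c, hc⟩ := h
  have : B = (c : Matrix (Fin n) (Fin n) K) * A * (c⁻¹ : (Matrix (Fin n) (Fin n) K)ˣ) := by
    rw [hc.eq, mul_assoc, Units.mul_inv, mul_one]
  rw [this, Matrix.trace_mul_cycle, Units.inv_mul, one_mul]

theorem isConj_toMatrix (D : Matrix (Fin n) (Fin n) K) (b : Module.Basis (Fin n) K (Fin n → K)) :
    IsConj D (LinearMap.toMatrix b b D.mulVecLin) := by
  let e := Pi.basisFun K (Fin n)
  have h1 : b.toMatrix e * e.toMatrix b = 1 := b.toMatrix_mul_toMatrix_flip e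
  have h2 : e.toMatrix b * b.toMatrix e = 1 := e.toMatrix_mul_toMatrix_flip b
  refine ⟨⟨b.toMatrix e, e.toMatrix b, h1, h2⟩, ?_⟩
  have h3 := basis_toMatrix_mul_linearMap_toMatrix_mul_basis_toMatrix e b e b D.mulVecLin
  have h4 : LinearMap.toMatrix e e D.mulVecLin = D := by
    rw [LinearMap.toMatrix_eq_toMatrix', ← Matrix.toLin'_apply', LinearMap.toMatrix'_toLin']
  rw [h4] at h3
  change b.toMatrix e * D = LinearMap.toMatrix b b D.mulVecLin * b.toMatrix e
  conv_lhs => rw [← h3]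
  rw [← mul_assoc, ← mul_assoc, h1, one_mul]

theorem Module.End.exists_sub_smul_mem [IsAlgClosed K] {V : Type*} [AddCommGroup V] [Module K V]
    [FiniteDimensional K V] (f : Module.End K V) {p : Submodule K V} (hp : p ≠ ⊤)
    (hfp : ∀ v ∈ p, f v ∈ p) : ∃ w ∉ p, ∃ μ : K, f w - μ • w ∈ p := by
  have : Nontrivial (V ⧸ p) := Submodule.Quotient.nontrivial_iff.2 hp
  obtain ⟨μ, hμ⟩ := Module.End.exists_eigenvalue (p.mapQ p f hfp)
  obtain ⟨w', hw'⟩ := hμ.exists_hasEigenvector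
  obtain ⟨w, rfl⟩ := p.mkQ_surjective w'
  refine ⟨w, fun h => hw'.2 ((Submodule.Quotient.mk_eq_zero p).2 h), μ, ?_⟩
  have := hw'.apply_eq_smul
  rw [Submodule.mkQ_apply, Submodule.mapQ_apply, ← Submodule.Quotient.mk_smul,
    Submodule.Quotient.eq] at this
  exact this

theorem Module.End.exists_flag_extending [IsAlgClosed K] {V : Type*} [AddCommGroup V] [Module K V]
    [FiniteDimensional K V] (f : Module.End K V) {k m : ℕ} (hkm : k ≤ m)
    (hm : m ≤ Module.finrank K V) {v : Fin k → V} (hv : LinearIndependent K v)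
    (hf : ∀ j, f (v j) ∈ Submodule.span K (v '' Set.Iic j)) :
    ∃ w : Fin m → V, LinearIndependent K w ∧
      (∀ j, f (w j) ∈ Submodule.span K (w '' Set.Iic j)) ∧
      ∀ j : Fin k, w (j.castLE hkm) = v j := by
  induction m, hkm using Nat.le_induction with
  | base => exact ⟨v, hv, hf, fun j => rfl⟩
  | succ m hkm ih =>
    obtain ⟨w, hw, hfw, hwv⟩ := ih (by omega)
    have hp : Submodule.span K (Set.range w) ≠ ⊤ := by
      intro h
      have h1 := finrank_span_eq_card hw
      rw [h, finrank_top, Fintype.card_fin] at h1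
      omega
    obtain ⟨x, hx, μ, hμ⟩ := f.exists_sub_smul_mem hp (by
      intro y hy
      induction hy using Submodule.span_induction with
      | mem y hy =>
        obtain ⟨j, rfl⟩ := hy
        exact Submodule.span_mono (Set.image_subset_range _ _) (hfw j)
      | zero => simp
      | add y z _ _ h1 h2 => rw [map_add]; exact add_mem h1 h2
      | smul a y _ h => rw [map_smul]; exact Submodule.smul_mem _ _ h)
    refine ⟨Fin.snoc w x, linearIndependent_finSnoc.2 ⟨hw, hx⟩, fun j => ?_, fun j => ?_⟩
    · induction j using Fin.lastCases with
      | last =>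
        rw [Fin.snoc_last, ← sub_add_cancel (f x) (μ • x)]
        refine add_mem (Submodule.span_mono ?_ hμ) (Submodule.smul_mem _ _
          (Submodule.subset_span ⟨Fin.last m, by simp, by simp⟩))
        rintro _ ⟨i, rfl⟩
        exact ⟨i.castSucc, Fin.le_last _, by simp⟩
      | cast j =>
        rw [Fin.snoc_castSucc]
        refine Submodule.span_mono ?_ (hfw j)
        rintro _ ⟨i, hi, rfl⟩
        exact ⟨i.castSucc, by simpa using hi, by simp⟩
    · rw [← hwv j]
      exact Fin.snoc_castSucc (α := fun _ => V) x w (j.castLE hkm)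

theorem exists_isConj_upper [IsAlgClosed K] (D : Matrix (Fin n) (Fin n) K) {k : ℕ} (hk : k ≤ n)
    {v : Fin k → Fin n → K} (hv : LinearIndependent K v)
    (hD : ∀ j, D *ᵥ v j ∈ Submodule.span K (v '' Set.Iic j)) :
    ∃ T : Matrix (Fin n) (Fin n) K, IsConj D T ∧ (∀ i j, j < i → T i j = 0) ∧
      ∀ (c : Fin k → K) (j : Fin k), D *ᵥ v j = ∑ i, c i • v i →
        ∀ i : Fin k, T (i.castLE hk) (j.castLE hk) = c i := by
  obtain ⟨w, hw, hDw, hwv⟩ := Module.End.exists_flag_extending D.mulVecLin hk (by simp) hv hD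
  rcases Nat.eq_zero_or_pos n with rfl | hn
  · exact ⟨D, IsConj.refl D, fun i => i.elim0, fun _ j => (j.castLE hk).elim0⟩
  have : Nonempty (Fin n) := ⟨⟨0, hn⟩⟩
  let b := basisOfLinearIndependentOfCardEqFinrank hw (by simp)
  have hb : ⇑b = w := coe_basisOfLinearIndependentOfCardEqFinrank hw (by simp)
  refine ⟨_, isConj_toMatrix D b, fun i j hij => ?_, fun c j hc i => ?_⟩
  · rw [LinearMap.toMatrix_apply]
    have := hDw j
    rw [← hb, b.mem_span_image] at this
    by_contra h
    exact absurd (this (Finsupp.mem_support_iff.2 h)) (by simpa using hij)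
  · rw [LinearMap.toMatrix_apply, hb, hwv, Matrix.mulVecLin_apply, hc]
    simp only [← hwv, ← hb, map_sum, map_smul, Module.Basis.repr_self, Finsupp.smul_single,
      smul_eq_mul, mul_one, Finsupp.finsetSum_apply, Finsupp.single_apply,
      (Fin.castLE_injective hk).eq_iff, Finset.sum_ite_eq', Finset.mem_univ, if_true]

theorem exists_isConj_upper_of_pair [IsAlgClosed K] {D : Matrix (Fin n) (Fin n) K} (hn : 2 ≤ n)
    {u w : Fin n → K} (huw : LinearIndependent K ![u, w]) {μ ρ c : K}
    (hu : D *ᵥ u = μ • u) (hw : D *ᵥ w = ρ • w + c • u) :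
    ∃ T : Matrix (Fin n) (Fin n) K, IsConj D T ∧ (∀ i j, j < i → T i j = 0) ∧
      T ⟨0, by omega⟩ ⟨0, by omega⟩ = μ ∧ T ⟨1, by omega⟩ ⟨1, by omega⟩ = ρ ∧
      T ⟨0, by omega⟩ ⟨1, by omega⟩ = c := by
  obtain ⟨T, h1, h2, h3⟩ := exists_isConj_upper D hn huw (by
    intro j
    fin_cases j
    · simp only [Fin.zero_eta, Matrix.cons_val_zero, hu]
      exact Submodule.smul_mem _ _ (Submodule.subset_span ⟨0, by simp⟩)
    · simp only [Fin.mk_one, Matrix.cons_val_one, Matrix.cons_val_zero, hw]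
      exact add_mem (Submodule.smul_mem _ _ (Submodule.subset_span ⟨1, by simp⟩))
        (Submodule.smul_mem _ _ (Submodule.subset_span ⟨0, by simp⟩)))
  refine ⟨T, h1, h2, ?_, ?_, ?_⟩
  · exact h3 ![μ, 0] 0 (by simp [hu]) 0
  · exact h3 ![c, ρ] 1 (by simp [hw, add_comm]) 1
  · exact h3 ![c, ρ] 1 (by simp [hw, add_comm]) 0

theorem exists_isConj_upper_of_eigenvector [IsAlgClosed K] {D : Matrix (Fin n) (Fin n) K}
    (hn : 1 ≤ n) {u : Fin n → K} (h0 : u ≠ 0) {μ : K} (hu : D *ᵥ u = μ • u) :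
    ∃ T : Matrix (Fin n) (Fin n) K, IsConj D T ∧ (∀ i j, j < i → T i j = 0) ∧
      T ⟨0, by omega⟩ ⟨0, by omega⟩ = μ := by
  obtain ⟨T, h1, h2, h3⟩ := exists_isConj_upper D hn (v := fun _ => u)
    (.of_subsingleton 0 h0) (by
      intro j
      rw [hu]
      exact Submodule.smul_mem _ _ (Submodule.subset_span ⟨0, by simp, rfl⟩))
  exact ⟨T, h1, h2, h3 (fun _ => μ) 0 (by simp [hu]) 0⟩

theorem exists_isConj_triangular [IsAlgClosed K] (D : Matrix (Fin n) (Fin n) K) :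
    ∃ T : Matrix (Fin n) (Fin n) K, IsConj D T ∧ ∀ i j, j < i → T i j = 0 := by
  obtain ⟨T, h1, h2, -⟩ := exists_isConj_upper D (Nat.zero_le n) (v := Fin.elim0)
    (linearIndependent_empty_type) (fun j => j.elim0)
  exact ⟨T, h1, h2⟩

theorem exists_mulVec_eq_diag_smul {D T : Matrix (Fin n) (Fin n) K} (h : IsConj D T)
    (hT : ∀ i j, j < i → T i j = 0) (i : Fin n) : ∃ v ≠ 0, D *ᵥ v = T i i • v := by
  obtain ⟨c, hc⟩ := h
  have h1 : (T - Matrix.scalar (Fin n) (T i i)).det = 0 := by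
    rw [Matrix.det_of_isUpperTriangular]
    · exact Finset.prod_eq_zero (Finset.mem_univ i) (by simp)
    · intro a b hab
      have hne : a ≠ b := ne_of_gt hab
      simp [hT a b hab, hne]
  have h2 : (D - Matrix.scalar (Fin n) (T i i)).det = 0 := by
    have h3 : (c : Matrix (Fin n) (Fin n) K) * (D - Matrix.scalar (Fin n) (T i i)) =
        (T - Matrix.scalar (Fin n) (T i i)) * c := by
      rw [mul_sub, sub_mul, hc.eq, (Matrix.scalar_commute _ (Commute.all _) _).eq]
    have h4 := congrArg Matrix.det h3
    rw [Matrix.det_mul, Matrix.det_mul, h1, zero_mul] at h4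
    exact (mul_eq_zero.1 h4).resolve_left
      (((Matrix.isUnit_iff_isUnit_det _).1 c.isUnit).ne_zero)
  obtain ⟨v, hv, hv'⟩ := Matrix.exists_mulVec_eq_zero_iff.2 h2
  refine ⟨v, hv, ?_⟩
  rw [Matrix.sub_mulVec, sub_eq_zero] at hv'
  rw [hv']
  ext j
  simp [Matrix.mulVec_diagonal]

theorem linearIndependent_pair_of_eigenvectors {D : Matrix (Fin n) (Fin n) K} {u w : Fin n → K}
    (hu0 : u ≠ 0) (hw0 : w ≠ 0) {μ ρ : K} (hμρ : μ ≠ ρ)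
    (hu : D *ᵥ u = μ • u) (hw : D *ᵥ w = ρ • w) : LinearIndependent K ![u, w] := by
  rw [LinearIndependent.pair_iff]
  intro s t hst
  have h1 : s • (μ • u) + t • (ρ • w) = 0 := by
    rw [← hu, ← hw, ← Matrix.mulVec_smul, ← Matrix.mulVec_smul, ← Matrix.mulVec_add, hst,
      Matrix.mulVec_zero]
  have h2 : (s * (μ - ρ)) • u = 0 := by
    have : (s * (μ - ρ)) • u = (s • (μ • u) + t • (ρ • w)) - ρ • (s • u + t • w) := by module
    rw [this, h1, hst]; simp
  have hs : s = 0 := by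
    rcases smul_eq_zero.1 h2 with h | h
    · exact (mul_eq_zero.1 h).resolve_right (sub_ne_zero.2 hμρ)
    · exact absurd h hu0
  subst hs
  simp only [zero_smul, zero_add, smul_eq_zero] at hst
  exact ⟨rfl, hst.resolve_right hw0⟩

/-- A nonzero trace-zero matrix is conjugate to an upper triangular matrix whose `(0, 1)` entry
does not vanish. -/
theorem exists_isConj_upper_zero_one_ne [IsAlgClosed K] [CharZero K] (hn : 2 ≤ n)
    {D : Matrix (Fin n) (Fin n) K} (htr : D.trace = 0) (hD : D ≠ 0) :
    ∃ T : Matrix (Fin n) (Fin n) K, IsConj D T ∧ (∀ i j, j < i → T i j = 0) ∧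
      T ⟨0, by omega⟩ ⟨1, by omega⟩ ≠ 0 := by
  suffices ∃ u w : Fin n → K, ∃ μ ρ c : K, LinearIndependent K ![u, w] ∧ c ≠ 0 ∧
      D *ᵥ u = μ • u ∧ D *ᵥ w = ρ • w + c • u by
    obtain ⟨u, w, μ, ρ, c, huw, hc, hu, hw⟩ := this
    obtain ⟨T, h1, h2, -, -, h3⟩ := exists_isConj_upper_of_pair hn huw hu hw
    exact ⟨T, h1, h2, h3 ▸ hc⟩
  by_cases hex : ∃ u w : Fin n → K, ∃ μ ρ : K, u ≠ 0 ∧ w ≠ 0 ∧ μ ≠ ρ ∧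
      D *ᵥ u = μ • u ∧ D *ᵥ w = ρ • w
  · obtain ⟨u, w, μ, ρ, hu0, hw0, hμρ, hu, hw⟩ := hex
    refine ⟨u, w + u, μ, ρ, μ - ρ, ?_, sub_ne_zero.2 hμρ, hu, ?_⟩
    · have := linearIndependent_pair_of_eigenvectors hu0 hw0 hμρ hu hw
      rw [LinearIndependent.pair_iff] at this ⊢
      intro s t hst
      have h := this (s + t) t (by rw [← hst]; module)
      exact ⟨by simpa [h.2] using h.1, h.2⟩
    · rw [Matrix.mulVec_add, hu, hw]; module
  · obtain ⟨T, hconj, hT⟩ := exists_isConj_triangular D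
    have hsame : ∀ i, T i i = T ⟨0, by omega⟩ ⟨0, by omega⟩ := by
      intro i
      by_contra hne
      obtain ⟨u, hu0, hu⟩ := exists_mulVec_eq_diag_smul hconj hT i
      obtain ⟨w, hw0, hw⟩ := exists_mulVec_eq_diag_smul hconj hT ⟨0, by omega⟩
      exact hex ⟨u, w, _, _, hu0, hw0, hne, hu, hw⟩
    have hzero : T ⟨0, by omega⟩ ⟨0, by omega⟩ = 0 := by
      have := hconj.trace_eq
      rw [htr, Matrix.trace] at this
      simp only [Matrix.diag_apply, hsame, Finset.sum_const, Finset.card_univ, Fintype.card_fin,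
        nsmul_eq_mul] at this
      exact (mul_eq_zero.1 this.symm).resolve_left (Nat.cast_ne_zero.2 (by omega))
    obtain ⟨v, hv0, hv⟩ := exists_mulVec_eq_diag_smul hconj hT ⟨0, by omega⟩
    rw [hzero] at hv
    have hker : LinearMap.ker D.mulVecLin ≠ ⊤ := by
      intro h
      apply hD
      rw [LinearMap.ker_eq_top] at h
      exact Matrix.toLin'.map_eq_zero_iff.1 h
    obtain ⟨w, hw, ρ, hρ⟩ := Module.End.exists_sub_smul_mem D.mulVecLin hker (by
      intro v hv
      rw [LinearMap.mem_ker.1 hv]; simp)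
    rw [LinearMap.mem_ker, Matrix.mulVecLin_apply] at hw
    rw [LinearMap.mem_ker, Matrix.mulVecLin_apply, Matrix.mulVecLin_apply, Matrix.mulVec_sub,
      Matrix.mulVec_smul, sub_eq_zero] at hρ
    have hρ0 : ρ = 0 := by
      by_contra hne
      exact hex ⟨D *ᵥ w, v, ρ, 0, hw, hv0, hne, hρ, hv⟩
    rw [hρ0, zero_smul] at hρ
    refine ⟨D *ᵥ w, w, 0, 0, 1, ?_, one_ne_zero, by simpa using hρ, by simp⟩
    rw [LinearIndependent.pair_iff]
    intro s t hst
    have h1 := congrArg (D *ᵥ ·) hst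
    simp only [Matrix.mulVec_add, Matrix.mulVec_smul, hρ, smul_zero, zero_add, Matrix.mulVec_zero,
      smul_eq_zero, hw, or_false] at h1
    subst h1
    simp only [zero_smul, add_zero, smul_eq_zero, hw, or_false] at hst
    exact ⟨hst, rfl⟩
end

section
variable {K : Type*} [Field K] {n : ℕ}

/-- The block diagonal matrix with blocks `1` and `Q`. -/
def oneBlock (Q : Matrix (Fin n) (Fin n) K) : Matrix (Fin (n + 1)) (Fin (n + 1)) K :=
  Matrix.of (Fin.cons (Fin.cons 1 0) fun i => Fin.cons 0 (Q i))

theorem oneBlock_mul (Q R : Matrix (Fin n) (Fin n) K) :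
    oneBlock (Q * R) = oneBlock Q * oneBlock R := by
  ext i j
  refine Fin.cases ?_ (fun i => ?_) i <;> refine Fin.cases ?_ (fun j => ?_) j <;>
    simp [oneBlock, Matrix.mul_apply, Fin.sum_univ_succ]

theorem oneBlock_one : oneBlock (1 : Matrix (Fin n) (Fin n) K) = 1 := by
  ext i j
  refine Fin.cases ?_ (fun i => ?_) i <;> refine Fin.cases ?_ (fun j => ?_) j <;>
    simp [oneBlock, Matrix.one_apply, Fin.succ_ne_zero, (Fin.succ_ne_zero _).symm]

theorem exists_isConj_hollow [IsAlgClosed K] [CharZero K] (D : Matrix (Fin n) (Fin n) K)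
    (hD : D.trace = 0) : ∃ T : Matrix (Fin n) (Fin n) K, IsConj D T ∧ ∀ i, T i i = 0 := by
  induction n with
  | zero => exact ⟨D, IsConj.refl D, fun i => i.elim0⟩
  | succ n ih =>
    by_cases hex : ∃ v, LinearIndependent K ![v, D *ᵥ v]
    · obtain ⟨v, hv⟩ := hex
      have hn : 2 ≤ n + 1 := by simpa using hv.fintype_card_le_finrank
      obtain ⟨w, hw, -, hwv⟩ := Module.End.exists_flag_extending (0 : Module.End K _) hn
        (by simp) hv (by simp)
      let b := basisOfLinearIndependentOfCardEqFinrank hw (by simp)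
      have hb : ⇑b = w := coe_basisOfLinearIndependentOfCardEqFinrank hw (by simp)
      have hA := isConj_toMatrix D b
      set A := LinearMap.toMatrix b b D.mulVecLin with hAdef
      have hA0 : A 0 0 = 0 := by
        have h0 : b 0 = v := by rw [hb]; exact hwv 0
        have h1 : b (Fin.castLE hn 1) = D *ᵥ v := by rw [hb]; exact hwv 1
        have hne : (Fin.castLE hn 1 : Fin (n + 1)) ≠ 0 := by simp [Fin.ext_iff]
        rw [hAdef, LinearMap.toMatrix_apply, h0, Matrix.mulVecLin_apply, ← h1,
          Module.Basis.repr_self, Finsupp.single_eq_of_ne hne.symm]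
      have htr : (A.submatrix Fin.succ Fin.succ).trace = 0 := by
        have := hA.trace_eq
        rw [hD] at this
        simpa [Matrix.trace, Fin.sum_univ_succ, hA0] using this.symm
      obtain ⟨T, ⟨c, hc⟩, hT⟩ := ih _ htr
      refine ⟨oneBlock c.val * A * oneBlock c⁻¹.val, hA.trans ⟨⟨oneBlock c.val, oneBlock c⁻¹.val,
        ?_, ?_⟩, ?_⟩, fun i => ?_⟩
      · rw [← oneBlock_mul, Units.mul_inv, oneBlock_one]
      · rw [← oneBlock_mul, Units.inv_mul, oneBlock_one]
      · change oneBlock c.val * A = oneBlock c.val * A * oneBlock c⁻¹.val * oneBlock c.val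
        rw [mul_assoc, ← oneBlock_mul, Units.inv_mul, oneBlock_one, mul_one]
      · have hT' : T = c.val * A.submatrix Fin.succ Fin.succ * c⁻¹.val := by
          rw [hc.eq, mul_assoc, Units.mul_inv, mul_one]
        refine Fin.cases ?_ (fun i => ?_) i
        · simp [oneBlock, Matrix.mul_apply, Fin.sum_univ_succ, hA0]
        · rw [← hT i, hT']
          simp [oneBlock, Matrix.mul_apply, Fin.sum_univ_succ]
    · obtain ⟨a, ha⟩ := LinearMap.exists_eq_smul_id_of_forall_notLinearIndependent
        (f := D.mulVecLin) (fun v hv => hex ⟨v, hv⟩)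
      have hDa : D = a • 1 := by
        apply Matrix.toLin'.injective
        rw [Matrix.toLin'_apply', ha, map_smul, Matrix.toLin'_one]
        rfl
      rw [hDa, Matrix.trace_smul, Matrix.trace_one, Fintype.card_fin, smul_eq_mul] at hD
      have ha0 : a = 0 := (mul_eq_zero.1 hD).resolve_right (Nat.cast_ne_zero.2 (by omega))
      exact ⟨D, IsConj.refl D, fun i => by simp [hDa, ha0]⟩

theorem exists_iterate_lie_eq [IsAlgClosed K] [CharZero K] {D : Matrix (Fin n) (Fin n) K}
    (hD : D.trace = 0) (k : ℕ) :
    ∃ d z : Matrix (Fin n) (Fin n) K, (fun t => ⁅d, t⁆)^[k] z = D := by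
  obtain ⟨T, hDT, hT⟩ := exists_isConj_hollow D hD
  obtain ⟨φ, hφ⟩ := hDT.symm.exists_algEquiv (K := K)
  suffices h : ∃ d z : Matrix (Fin n) (Fin n) K, (fun t => ⁅d, t⁆)^[k] z = T by
    obtain ⟨d, z, h⟩ := h
    refine ⟨φ d, φ z, ?_⟩
    have hs : Function.Semiconj φ (fun t => ⁅d, t⁆) (fun t => ⁅φ d, t⁆) := fun t => by
      simp [Ring.lie_def]
    rw [← hs.iterate_right k z, h, hφ]
  refine ⟨Matrix.diagonal fun i => (i : K), Matrix.of fun i j => T i j / ((i : K) - j) ^ k, ?_⟩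
  induction k with
  | zero => ext i j; simp
  | succ k ih =>
    rw [Function.iterate_succ_apply, ← ih]
    congr 1
    ext i j
    rw [ih, Ring.lie_def, Matrix.sub_apply, Matrix.diagonal_mul, Matrix.mul_diagonal,
      Matrix.of_apply, Matrix.of_apply]
    rcases eq_or_ne i j with rfl | hij
    · simp [hT]
    · have : ((i : ℕ) : K) - (j : ℕ) ≠ 0 := by
        rw [sub_ne_zero]
        exact fun h => hij (Fin.ext (Nat.cast_injective h))
      field_simp
      ring
end

section
variable {K : Type*} [Field K] {n : ℕ}

theorem exists_ne_zero_sum_mul_eq_zero [CharZero K] {ι : Type*} [DecidableEq ι] (s : Finset ι)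
    (l : ι → K) {i j : ι} (hij : i ≠ j) (hi : i ∈ s) (hj : j ∈ s) (hli : l i ≠ 0)
    (hlj : l j ≠ 0) : ∃ y : ι → K, (∀ k, y k ≠ 0) ∧ ∑ k ∈ s, l k * y k = 0 := by
  obtain ⟨t, ht0, ht⟩ : ∃ t : K, t ≠ 0 ∧ ∑ k ∈ (s.erase i).erase j, l k + l j * t ≠ 0 := by
    by_cases h : ∑ k ∈ (s.erase i).erase j, l k + l j * 1 = 0
    · refine ⟨2, two_ne_zero, fun h' => hlj ?_⟩
      linear_combination h' - h
    · exact ⟨1, one_ne_zero, h⟩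
  refine ⟨fun k => if k = i then -(∑ k ∈ (s.erase i).erase j, l k + l j * t) / l i
    else if k = j then t else 1, fun k => ?_, ?_⟩
  · dsimp only
    split_ifs
    · exact div_ne_zero (neg_ne_zero.2 ht) hli
    · exact ht0
    · exact one_ne_zero
  · rw [← Finset.add_sum_erase s _ hi, ← Finset.add_sum_erase (s.erase i) _
      (Finset.mem_erase.2 ⟨hij.symm, hj⟩)]
    have : ∑ k ∈ (s.erase i).erase j, l k * (if k = i then
        -(∑ k ∈ (s.erase i).erase j, l k + l j * t) / l i else if k = j then t else 1) =
        ∑ k ∈ (s.erase i).erase j, l k := by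
      refine Finset.sum_congr rfl fun k hk => ?_
      simp only [Finset.mem_erase] at hk
      simp [hk.1, hk.2.1]
    rw [this]
    simp only [if_true, hij.symm, if_false]
    field_simp
    ring

theorem exists_lie_lie_lie_eq_of_upper [CharZero K] (hn : 1 ≤ n) {R : ℕ → ℕ → K}
    (hR : ∀ i j, i < n → j < i → R i j = 0) (htr : ∑ k ∈ Finset.range n, R k k = 0)
    {y : ℕ → K} (hy : ∀ k, y k ≠ 0)
    (hsum : ∑ k ∈ Finset.range (n - 1), (∑ l ∈ Finset.range (k + 1), R l l) * y k = 0) :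
    ∃ x y z : Matrix (Fin n) (Fin n) K, ⁅⁅x, y⁆, ⁅x, z⁆⁆ = corner n R := by
  obtain ⟨Y, hY⟩ := exists_lie_superdiag_eq (n := n) (x := fun _ => 1)
    (R := bidiag (0 : ℕ → K) y⁻¹) (fun _ => one_ne_zero)
    (fun i j _ hij => by simp [bidiag, show j ≠ i by omega, show j ≠ i + 1 by omega])
    (by simp [bidiag]) (by simp [bidiag, add_assoc])
  obtain ⟨Z, hYZ, hZtr, hZ, hZsub, -⟩ := exists_lie_bidiag_eq (n := n) (by omega)
    (d := (0 : ℕ → K)) (ν := y⁻¹) (fun i => inv_ne_zero (hy i))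
    (fun i j hi hij => hR i j hi (by omega)) htr
    (fun i hi => by simp [hR (i + 1) i hi (by omega)])
  obtain ⟨Z', hZ'⟩ := exists_lie_superdiag_eq (n := n) (x := fun _ => 1)
    (fun _ => one_ne_zero) hZ hZtr (by
      rw [← hsum]
      refine Finset.sum_congr rfl fun k hk => ?_
      rw [← hZsub k (by rw [Finset.mem_range] at hk; omega), Pi.inv_apply]
      field_simp [hy k])
  exact ⟨_, corner n Y, corner n Z', by rw [hY, hZ', hYZ]⟩

theorem exists_lie_lie_lie_eq [IsAlgClosed K] [CharZero K] (hn : 3 ≤ n)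
    {D : Matrix (Fin n) (Fin n) K} (hD : D.trace = 0) :
    ∃ x y z : Matrix (Fin n) (Fin n) K, ⁅⁅x, y⁆, ⁅x, z⁆⁆ = D := by
  suffices h : ∃ R : ℕ → ℕ → K, IsConj D (corner n R) ∧ (∀ i j, i < n → j < i → R i j = 0) ∧
      ((∀ i < n - 1, ∑ l ∈ Finset.range (i + 1), R l l = 0) ∨
        R 0 0 ≠ 0 ∧ ∃ i, 0 < i ∧ i < n - 1 ∧ ∑ l ∈ Finset.range (i + 1), R l l ≠ 0) by
    obtain ⟨R, hconj, hR, hΛ⟩ := h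
    have htr : ∑ k ∈ Finset.range n, R k k = 0 := by
      rw [← trace_corner, ← hconj.trace_eq, hD]
    have hy : ∃ y : ℕ → K, (∀ k, y k ≠ 0) ∧
        ∑ k ∈ Finset.range (n - 1), (∑ l ∈ Finset.range (k + 1), R l l) * y k = 0 := by
      rcases hΛ with hΛ | ⟨h0, i, hi0, hi, hΛ⟩
      · exact ⟨fun _ => 1, fun _ => one_ne_zero,
          Finset.sum_eq_zero fun k hk => by rw [hΛ k (Finset.mem_range.1 hk), zero_mul]⟩
      · exact exists_ne_zero_sum_mul_eq_zero _ _ hi0.ne (Finset.mem_range.2 (by omega))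
          (Finset.mem_range.2 hi) (by simpa using h0) hΛ
    obtain ⟨y, hy0, hy⟩ := hy
    obtain ⟨a, b, c, h⟩ := exists_lie_lie_lie_eq_of_upper (by omega) hR htr hy0 hy
    obtain ⟨φ, hφ⟩ := hconj.symm.exists_algEquiv (K := K)
    refine ⟨φ a, φ b, φ c, ?_⟩
    rw [← hφ, ← h]
    simp [Ring.lie_def]
  have entry : ∀ (R : ℕ → ℕ → K) {i j : ℕ} (hi : i < n) (hj : j < n),
    R i j = corner n R ⟨i, hi⟩ ⟨j, hj⟩ := fun _ _ _ _ _ => rfl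
  by_cases hex : ∃ (u : Fin n → K) (μ : K), u ≠ 0 ∧ μ ≠ 0 ∧ D *ᵥ u = μ • u
  · obtain ⟨u, μ, hu0, hμ, hu⟩ := hex
    obtain ⟨T, hconj, hT, hT0⟩ := exists_isConj_upper_of_eigenvector (by omega) hu0 hu
    obtain ⟨R, rfl⟩ := exists_eq_corner T
    have hRu : ∀ i j, i < n → j < i → R i j = 0 := fun i j hi hij =>
      hT ⟨i, hi⟩ ⟨j, by omega⟩ hij
    have hR0 : R 0 0 = μ := hT0
    by_cases hi : ∃ i, 0 < i ∧ i < n - 1 ∧ ∑ l ∈ Finset.range (i + 1), R l l ≠ 0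
    · exact ⟨R, hconj, hRu, Or.inr ⟨hR0 ▸ hμ, hi⟩⟩
    · push Not at hi
      have hlast : R (n - 1) (n - 1) = 0 := by
        have h1 := hi (n - 2) (by omega) (by omega)
        rw [show n - 2 + 1 = n - 1 by omega] at h1
        have h2 : ∑ l ∈ Finset.range (n - 1 + 1), R l l = 0 := by
          rw [show n - 1 + 1 = n by omega, ← trace_corner, ← hconj.trace_eq, hD]
        rwa [Finset.sum_range_succ, h1, zero_add] at h2
      obtain ⟨v, hv0, hv⟩ := exists_mulVec_eq_diag_smul hconj hT ⟨n - 1, by omega⟩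
      rw [← entry R, hlast] at hv
      obtain ⟨T, hconj, hT, h00, h11, -⟩ := exists_isConj_upper_of_pair (by omega)
        (linearIndependent_pair_of_eigenvectors hu0 hv0 hμ hu hv) hu
        (show D *ᵥ v = (0 : K) • v + (0 : K) • u by rw [hv]; simp)
      obtain ⟨S, rfl⟩ := exists_eq_corner T
      rw [← entry S] at h00 h11
      refine ⟨S, hconj, fun i j hi hij => hT ⟨i, hi⟩ ⟨j, by omega⟩ hij,
        Or.inr ⟨h00 ▸ hμ, 1, one_pos, by omega, ?_⟩⟩
      simpa [Finset.sum_range_succ, h00, h11] using hμ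
  · obtain ⟨T, hconj, hT⟩ := exists_isConj_triangular D
    obtain ⟨R, rfl⟩ := exists_eq_corner T
    refine ⟨R, hconj, fun i j hi hij => hT ⟨i, hi⟩ ⟨j, by omega⟩ hij, Or.inl fun i hi => ?_⟩
    refine Finset.sum_eq_zero fun l hl => ?_
    rw [Finset.mem_range] at hl
    by_contra hne
    obtain ⟨u, hu0, hu⟩ := exists_mulVec_eq_diag_smul hconj hT ⟨l, by omega⟩
    exact hex ⟨u, _, hu0, hne, hu⟩

theorem Monotone.mul_sum_range_lt {a : ℕ → ℕ} (ha : Monotone a) (h0 : a 0 = 0) (h1 : 0 < a 1)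
    {i : ℕ} (hi : i + 1 < n) :
    n * ∑ k ∈ Finset.range (i + 1), a k < (i + 1) * ∑ k ∈ Finset.range n, a k := by
  obtain ⟨m, rfl⟩ : ∃ m, n = i + 1 + (m + 1) := ⟨n - i - 2, by omega⟩
  have hlow : ∑ k ∈ Finset.range (i + 1), a k ≤ i * a i := by
    rw [Finset.sum_range_succ', h0, add_zero]
    refine (Finset.sum_le_card_nsmul _ _ (a i) fun k hk => ha ?_).trans (by simp)
    rw [Finset.mem_range] at hk
    omega
  have hhigh : (m + 1) * a (i + 1) ≤ ∑ k ∈ Finset.range (m + 1), a (i + 1 + k) := by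
    have := Finset.card_nsmul_le_sum (Finset.range (m + 1)) (fun k => a (i + 1 + k)) (a (i + 1))
      fun k _ => ha (by omega)
    simpa using this
  have hmid : i * a i < (i + 1) * a (i + 1) := by
    have h2 := ha (Nat.le_succ i)
    have h3 := ha (show 1 ≤ i + 1 by omega)
    simp only [Nat.succ_eq_add_one] at h2
    nlinarith
  rw [Finset.sum_range_add _ (i + 1) (m + 1)]
  have h2 := Nat.mul_le_mul_left (m + 1) hlow
  have h3 := Nat.mul_le_mul_left (i + 1) hhigh
  have h4 := Nat.mul_lt_mul_of_pos_left hmid (Nat.succ_pos m)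
  simp only [Nat.succ_eq_add_one] at h4
  linarith

/-- Every nonzero trace-zero matrix has the form `[x, [[x, y], [x, z]]]`. -/
theorem exists_lie_lie_lie_lie_eq [IsAlgClosed K] [CharZero K] (hn : 3 ≤ n)
    {D : Matrix (Fin n) (Fin n) K} (hD : D.trace = 0) (hD0 : D ≠ 0) :
    ∃ x y z : Matrix (Fin n) (Fin n) K, ⁅x, ⁅⁅x, y⁆, ⁅x, z⁆⁆⁆ = D := by
  obtain ⟨T, hconj, hT, hT01⟩ := exists_isConj_upper_zero_one_ne (by omega) hD hD0
  obtain ⟨R, rfl⟩ := exists_eq_corner T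
  replace hT01 : R 0 1 ≠ 0 := hT01
  have hR : ∀ i j, i < n → j < i → R i j = 0 := fun i j hi hij => hT ⟨i, hi⟩ ⟨j, by omega⟩ hij
  have htr : ∑ k ∈ Finset.range n, R k k = 0 := by
    rw [← trace_corner, ← hconj.trace_eq, hD]
  have hnK : (n : K) ≠ 0 := Nat.cast_ne_zero.2 (by omega)
  suffices h : ∃ x y z : Matrix (Fin n) (Fin n) K, ⁅x, ⁅⁅x, y⁆, ⁅x, z⁆⁆⁆ = corner n R by
    obtain ⟨x, y, z, h⟩ := h
    obtain ⟨φ, hφ⟩ := hconj.symm.exists_algEquiv (K := K)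
    refine ⟨φ x, φ y, φ z, ?_⟩
    rw [← hφ, ← h]
    simp [Ring.lie_def]
  classical
  let x : ℕ → K := fun k => if R k (k + 1) = 0 then 1 else R k (k + 1)
  have hx : ∀ k, x k ≠ 0 := by
    intro k
    simp only [x]
    split_ifs with h
    · exact one_ne_zero
    · exact h
  obtain ⟨W, hxW, hWtr, hW, hWsub, hWdiag⟩ := exists_lie_bidiag_eq (n := n) (by omega)
    (d := (0 : ℕ → K)) (ν := x) hx (fun i j hi hij => hR i j hi (by omega)) htr
    (fun i hi => by simp [hR (i + 1) i hi (by omega)])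
  let a : ℕ → ℕ := fun k => ∑ l ∈ Finset.range k, if R l (l + 1) = 0 then 0 else 1
  have ha : Monotone a := monotone_nat_of_le_succ fun k => by
    simp only [a, Finset.sum_range_succ]; omega
  have hWa : ∀ k, W k k = W 0 0 + a k := by
    intro k
    induction k with
    | zero => simp [a]
    | succ k ih =>
      have h1 := hWdiag k
      have h2 : a (k + 1) = a k + if R k (k + 1) = 0 then 0 else 1 := by
        simp only [a, Finset.sum_range_succ]
      simp only [Pi.zero_apply, sub_self, zero_mul, sub_zero] at h1
      apply mul_left_cancel₀ (hx k)
      rw [h2]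
      simp only [x] at h1 ⊢
      split_ifs at h1 ⊢ with h
      · push_cast
        rw [ih] at h1
        linear_combination h1 + h
      · push_cast
        rw [ih] at h1
        linear_combination h1
  have hsumW : ∀ m, ∑ k ∈ Finset.range m, W k k =
      m * W 0 0 + (∑ k ∈ Finset.range m, a k : ℕ) := by
    intro m
    rw [Finset.sum_congr rfl fun k _ => hWa k, Finset.sum_add_distrib]
    simp
  have hω : ∀ i, i + 1 < n → ∑ k ∈ Finset.range (i + 1), W k k ≠ 0 := by
    intro i hi h
    have hlt := ha.mul_sum_range_lt (by simp [a]) (by simp [a, hT01]) hi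
    apply hlt.ne
    apply Nat.cast_injective (R := K)
    rw [hsumW] at h hWtr
    push_cast at h hWtr ⊢
    linear_combination (n : K) * h - (i + 1 : K) * hWtr
  obtain ⟨y, hy0, hy⟩ := exists_ne_zero_sum_mul_eq_zero (Finset.range (n - 1))
    (fun i => x i * ∑ k ∈ Finset.range (i + 1), W k k) (zero_ne_one)
    (Finset.mem_range.2 (by omega)) (Finset.mem_range.2 (by omega))
    (mul_ne_zero (hx _) (hω 0 (by omega))) (mul_ne_zero (hx _) (hω 1 (by omega)))
  let g : ℕ → K := fun i => (y i)⁻¹ * W (i + 1) i / ∑ k ∈ Finset.range (i + 1), W k k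
  let c : K := -(∑ k ∈ Finset.range n, ∑ l ∈ Finset.range k, g l) / n
  let d : ℕ → K := fun i => ∑ k ∈ Finset.range i, g k + c
  have hdtr : ∑ k ∈ Finset.range n, d k = 0 := by
    simp only [d, c, Finset.sum_add_distrib, Finset.sum_const, Finset.card_range, nsmul_eq_mul]
    field_simp
    ring
  obtain ⟨Y, hY⟩ := exists_lie_superdiag_eq (n := n) (R := bidiag d y⁻¹) hx
    (fun i j _ hij => by simp [bidiag, show j ≠ i by omega, show j ≠ i + 1 by omega])
    (by simpa [bidiag] using hdtr) (by simp [bidiag, add_assoc])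
  obtain ⟨Z, hYZ, hZtr, hZ, hZsub, -⟩ := exists_lie_bidiag_eq (n := n) (by omega)
    (d := d) (ν := y⁻¹) (fun i => inv_ne_zero (hy0 i)) hW hWtr (fun i hi => by
      simp only [d, g, Finset.sum_range_succ _ i, Pi.inv_apply]
      have := hω i hi
      rw [Finset.sum_range_succ] at this
      field_simp
      ring)
  obtain ⟨Z', hZ'⟩ := exists_lie_superdiag_eq (n := n) hx hZ hZtr (by
      rw [← hy]
      refine Finset.sum_congr rfl fun k hk => ?_
      rw [← hZsub k (by rw [Finset.mem_range] at hk; omega), Pi.inv_apply]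
      field_simp [hy0 k])
  exact ⟨_, corner n Y, corner n Z', by rw [hY, hZ', hYZ, hxW]⟩
end

section
variable {K : Type*} [Field K] {n : ℕ}

theorem exists_upper_mul_add_smul_mul_eq {b : K} {d e : ℕ → K} {R : ℕ → ℕ → K}
    (hne : ∀ i j, i < j → j < n → e j + b * e i ≠ 0 ∨ d i + b * d j ≠ 0)
    (hdiag : ∀ i < n, (1 + b) * (d i * e i) = R i i) (hR : ∀ i j, i < n → j < i → R i j = 0) :
    ∃ Y Z : ℕ → ℕ → K, (∀ i j, j < i → Y i j = 0) ∧ (∀ i j, j < i → Z i j = 0) ∧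
      (∀ i, Y i i = d i) ∧ (∀ i, Z i i = e i) ∧
      corner n Y * corner n Z + b • (corner n Z * corner n Y) = corner n R := by
  suffices h : ∀ m, ∃ Y Z : ℕ → ℕ → K, (∀ i j, j < i → Y i j = 0) ∧ (∀ i j, j < i → Z i j = 0) ∧
      (∀ i, Y i i = d i) ∧ (∀ i, Z i i = e i) ∧ ∀ i j, j < i + m → i < n → j < n →
        ∑ k ∈ Finset.range n, Y i k * Z k j + b * ∑ k ∈ Finset.range n, Z i k * Y k j = R i j by
    obtain ⟨Y, Z, hY, hZ, hd, he, h⟩ := h n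
    refine ⟨Y, Z, hY, hZ, hd, he, ?_⟩
    ext i j
    have := h i j (by omega) i.2 j.2
    rw [Finset.sum_range, Finset.sum_range] at this
    simpa [corner, Matrix.mul_apply] using this
  intro m
  induction m with
  | zero =>
    refine ⟨bidiag d 0, bidiag e 0, fun i j h => ?_, fun i j h => ?_, fun i => ?_, fun i => ?_,
      fun i j hij hi hj => ?_⟩
    · simp [bidiag, h.ne]
    · simp [bidiag, h.ne]
    · simp [bidiag]
    · simp [bidiag]
    · rw [hR i j hi hij]
      have h : ∀ p q : ℕ → K, ∑ k ∈ Finset.range n, bidiag p 0 i k * bidiag q 0 k j = 0 :=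
        fun p q => Finset.sum_eq_zero fun k _ => by
          by_cases h : k = i
          · have : j ≠ k := by omega
            simp [bidiag, this]
          · simp [bidiag, h]
      rw [h, h, mul_zero, add_zero]
  | succ m ih =>
    obtain ⟨Y, Z, hY, hZ, hd, he, h⟩ := ih
    rcases Nat.eq_zero_or_pos m with rfl | hm
    · refine ⟨Y, Z, hY, hZ, hd, he, fun i j hij hi hj => ?_⟩
      rcases Nat.lt_or_ge j i with hlt | hge
      · exact h i j (by omega) hi hj
      · obtain rfl : i = j := by omega
        have key : ∀ P Q : ℕ → ℕ → K, (∀ i j, j < i → P i j = 0) → (∀ i j, j < i → Q i j = 0) →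
            ∑ k ∈ Finset.range n, P i k * Q k i = P i i * Q i i := by
          intro P Q hP hQ
          refine Finset.sum_eq_single_of_mem i (Finset.mem_range.2 hi) fun k _ hk => ?_
          rcases Nat.lt_or_gt_of_ne hk with h | h
          · rw [hP i k h, zero_mul]
          · rw [hQ k i h, mul_zero]
        rw [key Y Z hY hZ, key Z Y hZ hY, hd, he, ← hdiag i hi]
        ring
    · have hsolve : ∀ i, ∃ u w : K, i + m < n →
          ∑ k ∈ Finset.range n, Y i k * Z k (i + m) +
            b * ∑ k ∈ Finset.range n, Z i k * Y k (i + m) +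
            (u * (e (i + m) + b * e i) + w * (d i + b * d (i + m))) = R i (i + m) := by
        intro i
        by_cases hi : i + m < n
        · set r := R i (i + m) - (∑ k ∈ Finset.range n, Y i k * Z k (i + m) +
            b * ∑ k ∈ Finset.range n, Z i k * Y k (i + m)) with hr
          rcases hne i (i + m) (by omega) hi with h | h
          · refine ⟨r / (e (i + m) + b * e i), 0, fun _ => ?_⟩
            rw [div_mul_cancel₀ _ h, hr]; ring
          · refine ⟨0, r / (d i + b * d (i + m)), fun _ => ?_⟩
            rw [div_mul_cancel₀ _ h, hr]; ring
        · exact ⟨0, 0, fun h => absurd h hi⟩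
      choose u w huw using hsolve
      let bump : (ℕ → ℕ → K) → (ℕ → K) → ℕ → ℕ → K := fun P p i j =>
        P i j + if j = i + m then p i else 0
      have hlow : ∀ P p i j, j < i + m → bump P p i j = P i j := fun P p i j hij => by
        simp [bump, hij.ne]
      have hhigh : ∀ P p i, bump P p i (i + m) = P i (i + m) + p i := fun P p i => by
        simp [bump]
      have hmul : ∀ (P Q : ℕ → ℕ → K) (p q : ℕ → K), (∀ i j, j < i → P i j = 0) →
          (∀ i j, j < i → Q i j = 0) → ∀ i j, j < i + m →
          ∑ k ∈ Finset.range n, bump P p i k * bump Q q k j =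
            ∑ k ∈ Finset.range n, P i k * Q k j := by
        intro P Q p q hP hQ i j hij
        refine Finset.sum_congr rfl fun k _ => ?_
        rcases Nat.lt_or_ge k i with h | h
        · rw [hlow P p i k (by omega), hP i k h, zero_mul, zero_mul]
        · rw [hlow Q q k j (by omega)]
          rcases Nat.lt_or_ge k (i + m) with h' | h'
          · rw [hlow P p i k h']
          · rw [hQ k j (by omega), mul_zero, mul_zero]
      have hmul' : ∀ (P Q : ℕ → ℕ → K) (p q : ℕ → K), (∀ i j, j < i → P i j = 0) →
          (∀ i j, j < i → Q i j = 0) → ∀ i, i + m < n →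
          ∑ k ∈ Finset.range n, bump P p i k * bump Q q k (i + m) =
            ∑ k ∈ Finset.range n, P i k * Q k (i + m) + p i * Q (i + m) (i + m) + P i i * q i := by
        intro P Q p q hP hQ i hi
        have hterm : ∀ k ∈ Finset.range n, bump P p i k * bump Q q k (i + m) =
            P i k * Q k (i + m) + (if k = i + m then p i * Q (i + m) (i + m) else 0) +
              (if k = i then P i i * q i else 0) := by
          intro k _
          by_cases h1 : k = i + m
          · subst h1
            rw [hhigh, hlow Q q (i + m) (i + m) (by omega)]
            simp [show m ≠ 0 by omega]
            ring
          · by_cases h2 : k = i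
            · subst h2
              rw [hhigh, hlow P p k k (by omega)]
              simp [show m ≠ 0 by omega]
              ring
            · have h3 : bump P p i k = P i k := by simp [bump, h1]
              have h4 : bump Q q k (i + m) = Q k (i + m) := by
                simp [bump, show i ≠ k from fun h => h2 h.symm]
              simp [h3, h4, h1, h2]
        rw [Finset.sum_congr rfl hterm, Finset.sum_add_distrib, Finset.sum_add_distrib]
        simp [hi, show i < n by omega]
      refine ⟨bump Y u, bump Z w, fun i j hij => ?_, fun i j hij => ?_, fun i => ?_, fun i => ?_,
        fun i j hij hi hj => ?_⟩
      · rw [hlow _ _ _ _ (by omega), hY i j hij]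
      · rw [hlow _ _ _ _ (by omega), hZ i j hij]
      · rw [hlow _ _ _ _ (by omega), hd]
      · rw [hlow _ _ _ _ (by omega), he]
      · rcases Nat.lt_or_ge j (i + m) with hlt | hge
        · rw [hmul Y Z u w hY hZ i j hlt, hmul Z Y w u hZ hY i j hlt, h i j hlt hi hj]
        · obtain rfl : j = i + m := by omega
          rw [hmul' Y Z u w hY hZ i hj, hmul' Z Y w u hZ hY i hj, ← huw i hj, hd, hd, he, he]
          ring

/-- The conditions on the diagonal of an upper triangular `Y` which allow one to solve
`Y * Z + b • (Z * Y) = T` for an upper triangular `T` with diagonal `l`, with `Y` and `Z` both of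
trace zero. -/
structure IsAdmissible (b : K) (l d : Fin n → K) : Prop where
  ne_zero : ∀ i, d i ≠ 0
  sum_eq_zero : ∑ i, d i = 0
  sum_div_eq_zero : ∑ i, l i / d i = 0
  add_mul_ne_zero : ∀ i j, i < j → l i = l j → d i + b * d j ≠ 0

theorem three_colouring [CharZero K] {l : Fin n → K} (hl : ∑ i, l i = 0) {A B : Finset (Fin n)}
    (hAB : Disjoint A B) (hA : A.Nonempty) (hC : (A ∪ B)ᶜ.Nonempty)
    (hy : ∑ i ∈ B, l i ≠ 0) (hxy : ∑ i ∈ A, l i + ∑ i ∈ B, l i ≠ 0)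
    {r : K} (hr : (B.card : K) * (∑ i ∈ A, l i) * r ^ 2 + (A.card * ∑ i ∈ A, l i +
      B.card * ∑ i ∈ B, l i + (A ∪ B)ᶜ.card * (∑ i ∈ A, l i + ∑ i ∈ B, l i)) * r +
      A.card * ∑ i ∈ B, l i = 0) :
    ∃ s : K, (∀ i, (if i ∈ A then 1 else if i ∈ B then r else s) ≠ 0) ∧
      ∑ i, (if i ∈ A then 1 else if i ∈ B then r else s) = 0 ∧
      ∑ i, l i / (if i ∈ A then 1 else if i ∈ B then r else s) = 0 := by
  set C := (A ∪ B)ᶜ with hCdef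
  set x := ∑ i ∈ A, l i
  set y := ∑ i ∈ B, l i
  have hAK : (A.card : K) ≠ 0 := Nat.cast_ne_zero.2 hA.card_pos.ne'
  have hCK : (C.card : K) ≠ 0 := Nat.cast_ne_zero.2 hC.card_pos.ne'
  have hr0 : r ≠ 0 := by
    rintro rfl
    exact mul_ne_zero hAK hy (by linear_combination hr)
  have hs0 : (A.card : K) + B.card * r ≠ 0 := by
    intro h
    exact mul_ne_zero (mul_ne_zero hCK hxy) hr0
      (by linear_combination hr - (x * r + y) * h)
  have hsplit : ∀ g : Fin n → K, ∑ i, g i = ∑ i ∈ A, g i + ∑ i ∈ B, g i + ∑ i ∈ C, g i := by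
    intro g
    rw [← Finset.sum_union hAB, hCdef, Finset.sum_add_sum_compl]
  have hsplit' : ∀ (h : Fin n → K → K) (s : K),
      ∑ i, h i (if i ∈ A then 1 else if i ∈ B then r else s) =
      ∑ i ∈ A, h i 1 + ∑ i ∈ B, h i r + ∑ i ∈ C, h i s := by
    intro h s
    rw [hsplit]
    congr 1
    · congr 1
      · exact Finset.sum_congr rfl fun i hi => by rw [if_pos hi]
      · exact Finset.sum_congr rfl fun i hi => by
          rw [if_neg (Finset.disjoint_right.1 hAB hi), if_pos hi]
    · refine Finset.sum_congr rfl fun i hi => ?_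
      rw [hCdef, Finset.mem_compl, Finset.mem_union, not_or] at hi
      rw [if_neg hi.1, if_neg hi.2]
  have hz : ∑ i ∈ C, l i = -(x + y) := by
    have := hsplit l
    rw [hl] at this
    linear_combination -this
  refine ⟨-(A.card + B.card * r) / C.card, fun i => ?_, ?_, ?_⟩
  · split_ifs
    · exact one_ne_zero
    · exact hr0
    · exact div_ne_zero (neg_ne_zero.2 hs0) hCK
  · rw [hsplit' (fun _ t => t)]
    simp only [Finset.sum_const, nsmul_eq_mul]
    field_simp
    ring
  · rw [hsplit' (fun i t => l i / t)]
    simp only [← Finset.sum_div]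
    rw [hz]
    change x / 1 + y / r + _ = 0
    rw [div_div_eq_mul_div, div_one, neg_mul, neg_div_neg_eq, add_div' _ _ _ hr0,
      div_add_div _ _ hr0 hs0, div_eq_zero_iff]
    left
    linear_combination hr

theorem exists_root_quadratic [IsAlgClosed K] {a b c : K} (ha : a ≠ 0) :
    ∃ r : K, a * r ^ 2 + b * r + c = 0 := by
  obtain ⟨r, hr⟩ := IsAlgClosed.exists_root
    (Polynomial.C a * Polynomial.X ^ 2 + Polynomial.C b * Polynomial.X + Polynomial.C c)
    (by rw [Polynomial.degree_quadratic ha]; decide)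
  exact ⟨r, by simpa [Polynomial.IsRoot] using hr⟩

theorem exists_isAdmissible_of_zero [CharZero K] (hn : 3 ≤ n) {b : K} (hb : 1 + b ≠ 0) :
    ∃ d : Fin n → K, IsAdmissible b 0 d := by
  obtain ⟨m, rfl⟩ : ∃ m, n = m + 1 := ⟨n - 1, by omega⟩
  have hm : (m : K) ≠ 0 := Nat.cast_ne_zero.2 (by omega)
  by_cases hbm : b = m
  · refine ⟨Fin.snoc (fun _ => 1) (-(m : K)), ⟨fun i => ?_, ?_, by simp, fun i j hij _ => ?_⟩⟩
    · refine Fin.lastCases ?_ (fun i => ?_) i <;> simp [hm]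
    · simp [Fin.sum_univ_castSucc]
    · induction i using Fin.lastCases with
      | last => exact absurd (Fin.le_last j) (not_le.2 hij)
      | cast i =>
        induction j using Fin.lastCases with
        | last =>
          simp only [Fin.snoc_castSucc, Fin.snoc_last, hbm]
          intro h
          have h2 : ((m * m : ℕ) : K) = (1 : ℕ) := by push_cast; linear_combination -h
          have h3 := Nat.cast_injective h2
          nlinarith
        | cast j => simpa using hb
  · refine ⟨Fin.cons (-(m : K)) (fun _ => 1), ⟨fun i => ?_, ?_, by simp, fun i j hij _ => ?_⟩⟩
    · refine Fin.cases ?_ (fun i => ?_) i <;> simp [hm]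
    · simp [Fin.sum_univ_succ]
    · induction j using Fin.cases with
      | zero => exact absurd (Fin.zero_le i) (not_le.2 hij)
      | succ j =>
        induction i using Fin.cases with
        | zero =>
          simp only [Fin.cons_zero, Fin.cons_succ, mul_one]
          intro h
          exact hbm (by linear_combination h)
        | succ i => simpa using hb

theorem exists_isAdmissible_of_some_zero [CharZero K] {b : K} (hb : 1 + b ≠ 0) {l : Fin n → K}
    (hl : ∑ i, l i = 0) (h0 : ∃ i, l i = 0) (h1 : ∃ i, l i ≠ 0) :
    ∃ d : Fin n → K, IsAdmissible b l d := by
  classical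
  set A := Finset.univ.filter fun i => l i = 0 with hA
  have hAK : (A.card : K) ≠ 0 := by
    obtain ⟨i, hi⟩ := h0
    exact Nat.cast_ne_zero.2 (Finset.card_pos.2 ⟨i, by simp [hA, hi]⟩).ne'
  have hBK : (Aᶜ.card : K) ≠ 0 := by
    obtain ⟨i, hi⟩ := h1
    exact Nat.cast_ne_zero.2 (Finset.card_pos.2 ⟨i, by simp [hA, hi]⟩).ne'
  have hd0 : ∀ i, (if l i = 0 then -(Aᶜ.card : K) / A.card else 1) ≠ 0 := fun i => by
    split_ifs
    · exact div_ne_zero (neg_ne_zero.2 hBK) hAK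
    · exact one_ne_zero
  refine ⟨fun i => if l i = 0 then -(Aᶜ.card : K) / A.card else 1, hd0, ?_, ?_,
    fun i j hij h => ?_⟩
  · rw [Finset.sum_ite, Finset.sum_const, Finset.sum_const, ← Finset.compl_filter, ← hA]
    simp only [nsmul_eq_mul]
    field_simp
    ring
  · refine Eq.trans (Finset.sum_congr rfl fun i _ => ?_) hl
    split_ifs with h <;> simp [h]
  · simp only [h]
    rw [← one_add_mul]
    exact mul_ne_zero hb (hd0 j)

theorem exists_isAdmissible_of_two_values [IsAlgClosed K] [CharZero K] {b : K} (hb : 1 + b ≠ 0)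
    {l : Fin n → K} (hl : ∑ i, l i = 0) {μ ρ : K} (hμ : μ ≠ 0) (hμρ : μ ≠ ρ)
(hρ : ∃ i, l i = ρ)
    (hcard : ∃ i j, i ≠ j ∧ l i = μ ∧ l j = μ) :
    ∃ d : Fin n → K, IsAdmissible b l d := by
  classical
  set M := Finset.univ.filter fun i => l i = μ with hM
  have hMne : M.Nonempty := by
    obtain ⟨i, -, -, hi, -⟩ := hcard
    exact ⟨i, by simp [hM, hi]⟩
  set i₀ := M.min' hMne with hi₀
  have hi₀M : i₀ ∈ M := M.min'_mem hMne
  set B := M.erase i₀ with hB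
  have hBne : B.Nonempty := by
    obtain ⟨i, j, hij, hi, hj⟩ := hcard
    by_cases h : i = i₀
    · exact ⟨j, by simp [hB, hM, hj, ← h, hij.symm]⟩
    · exact ⟨i, by simp [hB, hM, hi, h]⟩
  have hx : ∑ i ∈ {i₀}, l i = μ := by simpa [hM] using hi₀M
  have hy : ∑ i ∈ B, l i = B.card * μ := by
    rw [Finset.sum_congr rfl (g := fun _ => μ) fun i hi => by
      simpa [hM] using Finset.mem_of_mem_erase hi]
    simp
  have hC : ({i₀} ∪ B)ᶜ.Nonempty := by
    obtain ⟨i, hi⟩ := hρ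
    refine ⟨i, ?_⟩
    rw [Finset.mem_compl, hB, ← Finset.insert_eq, Finset.insert_erase hi₀M, hM]
    simp [hi, hμρ.symm]
  have hBK : (B.card : K) ≠ 0 := Nat.cast_ne_zero.2 hBne.card_pos.ne'
  have hBK1 : (1 + B.card : K) ≠ 0 := by
    have : ((1 + B.card : ℕ) : K) ≠ 0 := Nat.cast_ne_zero.2 (by omega)
    exact_mod_cast this
  obtain ⟨r, hr, hbr⟩ : ∃ r : K, (B.card : K) * r ^ 2 +
      (1 + B.card ^ 2 + ({i₀} ∪ B)ᶜ.card * (1 + B.card)) * r + B.card = 0 ∧ 1 + b * r ≠ 0 := by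
    obtain ⟨r, hr⟩ := exists_root_quadratic
      (b := (1 + B.card ^ 2 + ({i₀} ∪ B)ᶜ.card * (1 + B.card) : K)) (c := B.card) hBK
    by_cases h : 1 + b * r = 0
    · have hr0 : r ≠ 0 := by
        rintro rfl
        simp at h
      refine ⟨r⁻¹, ?_, fun h' => ?_⟩
      · field_simp
        linear_combination hr
      · have h2 : r = -b := by
          field_simp at h'
          linear_combination h'
        have hb1 : b = 1 := by
          have : (1 + b) * (1 - b) = 0 := by rw [h2] at h; linear_combination h
          have := (mul_eq_zero.1 this).resolve_left hb
          linear_combination -this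
        rw [h2, hb1] at hr
        have h3 : ((1 + B.card ^ 2 + ({i₀} ∪ B)ᶜ.card * (1 + B.card) : ℕ) : K) =
            (B.card + B.card : ℕ) := by
          push_cast
          linear_combination -hr
        have h4 := Nat.cast_injective h3
        have h5 := hC.card_pos
        nlinarith [sq_nonneg ((B.card : ℤ) - 1)]
    · exact ⟨r, hr, h⟩
  obtain ⟨s, h1, h2, h3⟩ := three_colouring hl (A := {i₀}) (B := B) (r := r)
    (by simp [hB]) (Finset.singleton_nonempty _) hC (by rw [hy]; exact mul_ne_zero hBK hμ)
    (by rw [hx, hy]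
        have := mul_ne_zero hBK1 hμ
        rwa [add_mul, one_mul] at this)
    (by rw [hx, hy, Finset.card_singleton]
        push_cast
        linear_combination μ * hr)
  refine ⟨_, h1, h2, h3, fun i j hij hl => ?_⟩
  by_cases hj : j = i₀
  · subst hj
    have hiM : i ∈ M := by
      have := (Finset.mem_filter.1 hi₀M).2
      simp [hM, hl, this]
    exact absurd (M.min'_le i hiM) (not_le.2 hij)
  by_cases hi : i = i₀
  · have hjB : j ∈ B := by
      have := (Finset.mem_filter.1 hi₀M).2
      simp [hB, hM, hj, ← hl, hi, this]
    simpa [hi, hj, hjB] using hbr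
  · have hiff : i ∈ B ↔ j ∈ B := by simp [hB, hM, hl, hi, hj]
    have := h1 j
    simp only [Finset.mem_singleton, hi, hj, if_false, hiff] at this ⊢
    rw [← one_add_mul]
    exact mul_ne_zero hb this

theorem exists_isAdmissible_of_three_values [IsAlgClosed K] [CharZero K] {b : K} (hb : 1 + b ≠ 0)
    {l : Fin n → K} (hl : ∑ i, l i = 0) (hl0 : ∀ i, l i ≠ 0) {i j k : Fin n}
    (hij : l i ≠ l j) (hik : l i ≠ l k) (hjk : l j ≠ l k) :
    ∃ d : Fin n → K, IsAdmissible b l d := by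
  classical
  let M : Fin n → Finset (Fin n) := fun i => Finset.univ.filter fun j => l j = l i
  have hM : ∀ i j, j ∈ M i ↔ l j = l i := by simp [M]
  have hMK : ∀ i, ((M i).card : K) ≠ 0 := fun i =>
    Nat.cast_ne_zero.2 (Finset.card_pos.2 ⟨i, by simp [hM]⟩).ne'
  have hsum : ∀ i, ∑ j ∈ M i, l j = (M i).card * l i := fun i => by
    rw [Finset.sum_congr rfl fun j hj => (hM i j).1 hj]
    simp
  have hsum0 : ∀ i, ∑ j ∈ M i, l j ≠ 0 := fun i => by
    rw [hsum]; exact mul_ne_zero (hMK i) (hl0 i)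
  have main : ∀ i j k, l i ≠ l j → l i ≠ l k → l j ≠ l k →
      ∑ t ∈ M i, l t + ∑ t ∈ M j, l t ≠ 0 → ∃ d : Fin n → K, IsAdmissible b l d := by
    intro i j k hij hik hjk hne
    obtain ⟨r, hr⟩ := exists_root_quadratic (b := ((M i).card * ∑ t ∈ M i, l t +
      (M j).card * ∑ t ∈ M j, l t + (M i ∪ M j)ᶜ.card * (∑ t ∈ M i, l t + ∑ t ∈ M j, l t) : K))
      (c := (M i).card * ∑ t ∈ M j, l t) (mul_ne_zero (hMK j) (hsum0 i))
    obtain ⟨s, h1, h2, h3⟩ := three_colouring hl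
      (Finset.disjoint_left.2 fun t hi hj => hij (by rw [← (hM i t).1 hi, (hM j t).1 hj]))
      ⟨i, by simp [hM]⟩ ⟨k, by simp [hM, hik.symm, hjk.symm]⟩ (hsum0 j) hne hr
    refine ⟨_, h1, h2, h3, fun p q _ hpq => ?_⟩
    have := h1 q
    simp only [hM, hpq] at this ⊢
    rw [← one_add_mul]
    exact mul_ne_zero hb this
  by_cases h1 : ∑ t ∈ M i, l t + ∑ t ∈ M j, l t = 0
  · by_cases h2 : ∑ t ∈ M i, l t + ∑ t ∈ M k, l t = 0
    · refine main j k i hjk hij.symm hik.symm fun h3 => hsum0 i ?_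
      have : (2 : K) * ∑ t ∈ M i, l t = 0 := by linear_combination h1 + h2 - h3
      exact (mul_eq_zero.1 this).resolve_left two_ne_zero
    · exact main i k j hik hij hjk.symm h2
  · exact main i j k hij hik hjk h1

theorem exists_isAdmissible [IsAlgClosed K] [CharZero K] (hn : 3 ≤ n) {b : K} (hb : 1 + b ≠ 0)
    {l : Fin n → K} (hl : ∑ i, l i = 0) : ∃ d : Fin n → K, IsAdmissible b l d := by
  by_cases hzero : ∃ i, l i = 0
  · by_cases hne : ∃ i, l i ≠ 0
    · exact exists_isAdmissible_of_some_zero hb hl hzero hne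
    · push Not at hne
      obtain rfl : l = 0 := funext hne
      exact exists_isAdmissible_of_zero hn hb
  push Not at hzero
  let o : Fin n := ⟨0, by omega⟩
  obtain ⟨j, hj⟩ : ∃ j, l j ≠ l o := by
    by_contra! h
    simp only [h, Finset.sum_const, Finset.card_univ, Fintype.card_fin, nsmul_eq_mul] at hl
    exact mul_ne_zero (Nat.cast_ne_zero.2 (by omega)) (hzero o) hl
  by_cases hk : ∃ k, l k ≠ l o ∧ l k ≠ l j
  · obtain ⟨k, hk1, hk2⟩ := hk
    exact exists_isAdmissible_of_three_values hb hl hzero hj.symm hk1.symm hk2.symm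
  · have hval : ∀ k, l k = l o ∨ l k = l j := by
      intro k
      by_contra! h
      exact hk ⟨k, h⟩
    obtain ⟨k, hko, hkj⟩ : ∃ k, k ≠ o ∧ k ≠ j := by
      have := Finset.exists_mem_notMem_of_card_lt_card
        (s := {o, j}) (t := (Finset.univ : Finset (Fin n)))
        (by rw [Finset.card_univ, Fintype.card_fin]; exact lt_of_le_of_lt Finset.card_le_two hn)
      obtain ⟨k, -, hk⟩ := this
      exact ⟨k, by simpa using hk⟩
    rcases hval k with h | h
    · exact exists_isAdmissible_of_two_values hb hl (hzero o) hj.symm ⟨j, rfl⟩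
        ⟨k, o, hko, h, rfl⟩
    · exact exists_isAdmissible_of_two_values hb hl (hzero j) hj
        ⟨o, rfl⟩ ⟨k, j, hkj, h, rfl⟩

theorem exists_lie_mul_lie_add_smul_eq_of_ne [IsAlgClosed K] [CharZero K] (hn : 3 ≤ n) {b : K}
    (hb : 1 + b ≠ 0) {D : Matrix (Fin n) (Fin n) K} (hD : D.trace = 0) :
    ∃ x y z : Matrix (Fin n) (Fin n) K, ⁅x, y⁆ * ⁅x, z⁆ + b • (⁅x, z⁆ * ⁅x, y⁆) = D := by
  obtain ⟨T, hconj, hT⟩ := exists_isConj_triangular D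
  obtain ⟨R, rfl⟩ := exists_eq_corner T
  obtain ⟨φ, hφ⟩ := hconj.symm.exists_algEquiv (K := K)
  suffices h : ∃ x y z : Matrix (Fin n) (Fin n) K,
      ⁅x, y⁆ * ⁅x, z⁆ + b • (⁅x, z⁆ * ⁅x, y⁆) = corner n R by
    obtain ⟨x, y, z, h⟩ := h
    refine ⟨φ x, φ y, φ z, ?_⟩
    rw [← hφ, ← h]
    simp [Ring.lie_def]
  have hl : ∑ i : Fin n, R i i = 0 := by
    rw [← Finset.sum_range fun i => R i i, ← trace_corner, ← hconj.trace_eq, hD]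
  obtain ⟨d, hd⟩ := exists_isAdmissible hn hb hl
  obtain ⟨d', hd'⟩ : ∃ d' : ℕ → K, ∀ i : Fin n, d' i = d i :=
    ⟨fun i => if h : i < n then d ⟨i, h⟩ else 0, fun i => by simp⟩
  have hd0 : ∀ i < n, d' i ≠ 0 := fun i hi => by
    rw [hd' ⟨i, hi⟩]; exact hd.ne_zero _
  let e : ℕ → K := fun i => R i i / d' i / (1 + b)
  obtain ⟨Y, Z, hY, hZ, hYd, hZe, hYZ⟩ := exists_upper_mul_add_smul_mul_eq (n := n) (b := b)
    (d := d') (e := e) (R := R) (fun i j hij hj => by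
      by_contra! h
      obtain ⟨h1, h2⟩ := h
      have hi' := hd0 i (by omega)
      have hj' := hd0 j hj
      have hRR : R i i = R j j := by
        simp only [e] at h1
        have h3 : d' i = -b * d' j := by linear_combination h2
        have hb0 : b ≠ 0 := by
          rintro rfl
          exact hi' (by linear_combination h2)
        rw [h3] at h1
        field_simp at h1
        linear_combination -h1
      refine hd.add_mul_ne_zero ⟨i, by omega⟩ ⟨j, hj⟩ hij hRR ?_
      rw [← hd', ← hd']
      exact h2)
    (fun i hi => by
      have := hd0 i hi
      simp only [e]
      field_simp)
    (fun i j hi hij => hT ⟨i, hi⟩ ⟨j, by omega⟩ hij)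
  obtain ⟨Y', hY'⟩ := exists_lie_superdiag_eq (n := n) (x := fun _ => 1) (R := Y)
    (fun _ => one_ne_zero) (fun i j _ hij => hY i j (by omega))
    (by simp only [hYd]; rw [Finset.sum_range]; simpa only [hd'] using hd.sum_eq_zero)
    (Finset.sum_eq_zero fun k _ => by rw [hY _ _ (Nat.lt_succ_self k), mul_zero])
  obtain ⟨Z', hZ'⟩ := exists_lie_superdiag_eq (n := n) (x := fun _ => 1) (R := Z)
    (fun _ => one_ne_zero) (fun i j _ hij => hZ i j (by omega))
    (by
      simp only [hZe, e]
      rw [Finset.sum_range]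
      simp only [hd', ← Finset.sum_div]
      rw [hd.sum_div_eq_zero, zero_div])
    (Finset.sum_eq_zero fun k _ => by rw [hZ _ _ (Nat.lt_succ_self k), mul_zero])
  exact ⟨corner n (bidiag 0 fun _ => 1), corner n Y', corner n Z', by rw [hY', hZ', hYZ]⟩

theorem exists_smul_lie_mul_lie_add_eq [IsAlgClosed K] [CharZero K] (hn : 3 ≤ n) {a b : K}
    (hab : a ≠ 0 ∨ b ≠ 0) {D : Matrix (Fin n) (Fin n) K} (hD : D.trace = 0) :
    ∃ x y z : Matrix (Fin n) (Fin n) K,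
      a • (⁅x, y⁆ * ⁅x, z⁆) + b • (⁅x, z⁆ * ⁅x, y⁆) = D := by
  have main : ∀ a b : K, a ≠ 0 → ∃ x y z : Matrix (Fin n) (Fin n) K,
      a • (⁅x, y⁆ * ⁅x, z⁆) + b • (⁅x, z⁆ * ⁅x, y⁆) = D := by
    intro a b ha
    have hD' : (a⁻¹ • D).trace = 0 := by rw [Matrix.trace_smul, hD, smul_zero]
    obtain ⟨x, y, z, h⟩ : ∃ x y z : Matrix (Fin n) (Fin n) K,
        ⁅x, y⁆ * ⁅x, z⁆ + (a⁻¹ * b) • (⁅x, z⁆ * ⁅x, y⁆) = a⁻¹ • D := by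
      by_cases hb : 1 + a⁻¹ * b = 0
      · obtain ⟨x, y, z, h⟩ := exists_lie_lie_lie_eq hn hD'
        refine ⟨x, y, z, ?_⟩
        rw [← h, show a⁻¹ * b = -1 by linear_combination hb, Ring.lie_def ⁅x, y⁆, neg_one_smul,
          sub_eq_add_neg]
      · exact exists_lie_mul_lie_add_smul_eq_of_ne hn hb hD'
    refine ⟨x, y, z, ?_⟩
    have := congrArg (a • ·) h
    simpa [smul_smul, mul_inv_cancel_left₀ ha, mul_inv_cancel₀ ha] using this
  rcases hab with ha | hb
  · exact main a b ha
  · obtain ⟨x, y, z, h⟩ := main b a hb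
    exact ⟨x, z, y, by rw [add_comm]; exact h⟩
end

theorem exists_quadratic_eq {K : Type*} [Field K] [IsAlgClosed K] [CharZero K] {n : ℕ} {p q : K}
    (h : p ≠ 0 ∨ q ≠ 0) {D : Matrix (Fin n) (Fin n) K} (hD : D.trace = 0) :
    ∃ x y : Matrix (Fin n) (Fin n) K, p • (x * y) + q • (y * x) = D := by
  by_cases hpq : p + q = 0
  · have hp : p ≠ 0 := by
      rcases h with h | h
      · exact h
      · rintro rfl
        exact h (by simpa using hpq)
    obtain ⟨d, z, h⟩ := exists_iterate_lie_eq hD 1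
    refine ⟨p⁻¹ • d, z, ?_⟩
    rw [← h, Function.iterate_one, Ring.lie_def, smul_mul_assoc, mul_smul_comm, smul_smul,
      smul_smul, show q = -p by linear_combination hpq, neg_mul, mul_inv_cancel₀ hp, one_smul,
      neg_one_smul, sub_eq_add_neg]
  · refine ⟨(p + q)⁻¹ • D, 1, ?_⟩
    rw [mul_one, one_mul, ← add_smul, smul_smul, mul_inv_cancel₀ hpq, one_smul]

theorem exists_cubic_eq {K : Type*} [Field K] [IsAlgClosed K] [CharZero K] {n : ℕ}
    {c₁ c₂ c₃ c₄ c₅ c₆ : K} (h : ¬(c₁ = 0 ∧ c₂ = 0 ∧ c₃ = 0 ∧ c₄ = 0 ∧ c₅ = 0 ∧ c₆ = 0))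
    {D : Matrix (Fin n) (Fin n) K} (hD : D.trace = 0) :
    ∃ x y z : Matrix (Fin n) (Fin n) K, c₁ • (x * y * z) + c₂ • (x * z * y) + c₃ • (y * x * z) +
      c₄ • (y * z * x) + c₅ • (z * x * y) + c₆ • (z * y * x) = D := by
  have hquad : ∀ p q : K, (∀ x y : Matrix (Fin n) (Fin n) K, p • (x * y) + q • (y * x) ≠ D) →
      p = 0 ∧ q = 0 := fun p q hpq => by
    by_contra hne
    obtain ⟨x, y, hxy⟩ := exists_quadratic_eq (not_and_or.1 hne) hD
    exact hpq x y hxy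
  have hlie : ∀ p : K, (∀ d z : Matrix (Fin n) (Fin n) K, p • ⁅d, ⁅d, z⁆⁆ ≠ D) → p = 0 :=
    fun p hp => by
      by_contra hne
      obtain ⟨d, z, hdz⟩ := exists_iterate_lie_eq (D := p⁻¹ • D)
        (by rw [Matrix.trace_smul, hD, smul_zero]) 2
      refine hp d z ?_
      change ⁅d, ⁅d, z⁆⁆ = _ at hdz
      rw [hdz, smul_smul, mul_inv_cancel₀ hne, one_smul]
  by_contra! hne
  obtain ⟨h1, h2⟩ := hquad (c₁ + c₂ + c₅) (c₃ + c₄ + c₆) fun x y hxy => hne x y 1 (by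
    simp only [mul_one, one_mul]
    linear_combination (norm := module) hxy)
  obtain ⟨h3, h4⟩ := hquad (c₁ + c₃ + c₄) (c₂ + c₅ + c₆) fun y z hyz => hne 1 y z (by
    simp only [mul_one, one_mul]
    linear_combination (norm := module) hyz)
  obtain ⟨h5, h6⟩ := hquad (c₁ + c₂ + c₃) (c₄ + c₅ + c₆) fun x z hxz => hne x 1 z (by
    simp only [mul_one, one_mul]
    linear_combination (norm := module) hxz)
  obtain rfl : c₁ = c₆ := by linear_combination h3 - h2
  obtain rfl : c₂ = c₄ := by linear_combination h5 - h3
  obtain rfl : c₃ = c₅ := by linear_combination h5 - h1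
  have hww : ∀ d z : Matrix (Fin n) (Fin n) K,
      ⁅d, ⁅d, z⁆⁆ = d * d * z - 2 • (d * z * d) + z * d * d := fun d z => by
    simp only [Ring.lie_def]
    noncomm_ring
  have h2' := hlie (-c₂) fun d z hdz => hne d d z (by
    rw [← hdz, hww]
    linear_combination (norm := module) h5 • (d * d * z) + h5 • (z * d * d))
  have h3' := hlie (-c₃) fun d x hdx => hne x d d (by
    rw [← hdx, hww]
    linear_combination (norm := module) h5 • (d * d * x) + h5 • (x * d * d))
  have h2'' : c₂ = 0 := neg_eq_zero.1 h2'
  have h3'' : c₃ = 0 := neg_eq_zero.1 h3'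
  have h1'' : c₁ = 0 := by linear_combination h5 - h2'' - h3''
  exact h ⟨h1'', h2'', h3'', h2'', h3'', h1''⟩

theorem Fin.sum_perm_four {M : Type*} [AddCommMonoid M] (g : Fin 4 → Fin 4 → Fin 4 → Fin 4 → M) :
    ∑ σ : Equiv.Perm (Fin 4), g (σ 0) (σ 1) (σ 2) (σ 3) =
      (g 0 1 2 3 + g 0 1 3 2 + g 0 2 1 3 + g 0 2 3 1 + g 0 3 1 2 + g 0 3 2 1) +
      (g 1 0 2 3 + g 1 0 3 2 + g 1 2 0 3 + g 1 2 3 0 + g 1 3 0 2 + g 1 3 2 0) +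
      (g 2 0 1 3 + g 2 0 3 1 + g 2 1 0 3 + g 2 1 3 0 + g 2 3 0 1 + g 2 3 1 0) +
      (g 3 0 1 2 + g 3 0 2 1 + g 3 1 0 2 + g 3 1 2 0 + g 3 2 0 1 + g 3 2 1 0) := by
  simp only [← Equiv.Perm.decomposeFin.symm.sum_comp, Fintype.sum_prod_type, Fin.sum_univ_succ,
    show (1 : Fin 4) = Fin.succ 0 from rfl, show (2 : Fin 4) = Fin.succ (Fin.succ 0) from rfl,
    show (3 : Fin 4) = Fin.succ (Fin.succ (Fin.succ 0)) from rfl,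
    Equiv.Perm.decomposeFin_symm_apply_zero, Equiv.Perm.decomposeFin_symm_apply_succ,
    Finset.univ_unique, Finset.sum_singleton, Equiv.Perm.default_eq, Equiv.Perm.one_apply]
  simp only [Equiv.swap_apply_def, Fin.ext_iff]
  simp
  abel

/-- `mlEval` in degree four, with the coefficients indexed by words instead of permutations. -/
def wordSum {K : Type*} [Field K] {R : Type*} [Ring R] [Algebra K R]
    (c : Fin 4 → Fin 4 → Fin 4 → Fin 4 → K) (a : Fin 4 → R) : R :=
  ∑ σ : Equiv.Perm (Fin 4), c (σ 0) (σ 1) (σ 2) (σ 3) • (a (σ 0) * a (σ 1) * a (σ 2) * a (σ 3))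

theorem wordSum_vec {K : Type*} [Field K] {R : Type*} [Ring R] [Algebra K R]
    (c : Fin 4 → Fin 4 → Fin 4 → Fin 4 → K) (x y z w : R) :
    wordSum c ![x, y, z, w] =
      c 0 1 2 3 • (x * y * z * w) + c 0 1 3 2 • (x * y * w * z) + c 0 2 1 3 • (x * z * y * w) +
      c 0 2 3 1 • (x * z * w * y) + c 0 3 1 2 • (x * w * y * z) + c 0 3 2 1 • (x * w * z * y) +
      c 1 0 2 3 • (y * x * z * w) + c 1 0 3 2 • (y * x * w * z) + c 1 2 0 3 • (y * z * x * w) +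
      c 1 2 3 0 • (y * z * w * x) + c 1 3 0 2 • (y * w * x * z) + c 1 3 2 0 • (y * w * z * x) +
      c 2 0 1 3 • (z * x * y * w) + c 2 0 3 1 • (z * x * w * y) + c 2 1 0 3 • (z * y * x * w) +
      c 2 1 3 0 • (z * y * w * x) + c 2 3 0 1 • (z * w * x * y) + c 2 3 1 0 • (z * w * y * x) +
      c 3 0 1 2 • (w * x * y * z) + c 3 0 2 1 • (w * x * z * y) + c 3 1 0 2 • (w * y * x * z) +
      c 3 1 2 0 • (w * y * z * x) + c 3 2 0 1 • (w * z * x * y) + c 3 2 1 0 • (w * z * y * x) := by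
  rw [wordSum, Fin.sum_perm_four fun i j k l => c i j k l •
    (![x, y, z, w] i * ![x, y, z, w] j * ![x, y, z, w] k * ![x, y, z, w] l)]
  simp only [cons_val]
  abel

theorem wordSum_comp_perm {K : Type*} [Field K] {R : Type*} [Ring R] [Algebra K R]
    (c : Fin 4 → Fin 4 → Fin 4 → Fin 4 → K) (τ : Equiv.Perm (Fin 4)) (a : Fin 4 → R) :
    wordSum (fun i j k l => c (τ i) (τ j) (τ k) (τ l)) a = wordSum c (a ∘ τ.symm) :=
  Fintype.sum_equiv (Equiv.mulLeft τ) _ _ fun σ => by simp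

theorem exists_perm_of_nodup {i j k l : Fin 4} (h : [i, j, k, l].Nodup) :
    ∃ τ : Equiv.Perm (Fin 4), τ 0 = i ∧ τ 1 = j ∧ τ 2 = k ∧ τ 3 = l := by
  have hinj : Function.Injective ![i, j, k, l] := by
    rw [← List.nodup_ofFn]
    simpa using h
  exact ⟨Equiv.ofBijective _ (Finite.injective_iff_bijective.1 hinj), rfl, rfl, rfl, rfl⟩

section
variable {K : Type*} [Field K] {n : ℕ} {c : Fin 4 → Fin 4 → Fin 4 → Fin 4 → K}
  {D : Matrix (Fin n) (Fin n) K}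

theorem wordSum_ne_comp_perm (h : ∀ a, wordSum c a ≠ D) (τ : Equiv.Perm (Fin 4)) :
    ∀ a, wordSum (fun i j k l => c (τ i) (τ j) (τ k) (τ l)) a ≠ D := fun a => by
  rw [wordSum_comp_perm]
  exact h _

theorem insert_sum_eq_zero [IsAlgClosed K] [CharZero K] (hD : D.trace = 0)
    (h : ∀ a, wordSum c a ≠ D) (i j k l : Fin 4) (hijkl : [i, j, k, l].Nodup := by decide) :
    c i j k l + c i j l k + c i l j k + c l i j k = 0 := by
  obtain ⟨τ, rfl, rfl, rfl, rfl⟩ := exists_perm_of_nodup hijkl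
  replace h := wordSum_ne_comp_perm h τ
  generalize hc : (fun i j k l => c (τ i) (τ j) (τ k) (τ l)) = c' at h
  simp only [funext_iff] at hc
  simp only [hc]
  by_contra hne
  obtain ⟨x, y, z, hxyz⟩ := exists_cubic_eq
    (c₁ := c' 0 1 2 3 + c' 0 1 3 2 + c' 0 3 1 2 + c' 3 0 1 2)
    (c₂ := c' 0 2 1 3 + c' 0 2 3 1 + c' 0 3 2 1 + c' 3 0 2 1)
    (c₃ := c' 1 0 2 3 + c' 1 0 3 2 + c' 1 3 0 2 + c' 3 1 0 2)
    (c₄ := c' 1 2 0 3 + c' 1 2 3 0 + c' 1 3 2 0 + c' 3 1 2 0)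
    (c₅ := c' 2 0 1 3 + c' 2 0 3 1 + c' 2 3 0 1 + c' 3 2 0 1)
    (c₆ := c' 2 1 0 3 + c' 2 1 3 0 + c' 2 3 1 0 + c' 3 2 1 0) (fun h => hne h.1) hD
  refine h ![x, y, z, 1] ?_
  rw [wordSum_vec, ← hxyz]
  simp only [mul_one, one_mul]
  module

theorem wordSum_cube_eq (hA : ∀ (i j k l : Fin 4) (_ : [i, j, k, l].Nodup := by decide),
      c i j k l + c i j l k + c i l j k + c l i j k = 0) (d z : Matrix (Fin n) (Fin n) K) :
    wordSum c ![d, d, d, z] = -(c 3 0 1 2 + c 3 0 2 1 + c 3 1 0 2 + c 3 1 2 0 + c 3 2 0 1 +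
      c 3 2 1 0) • ⁅d, ⁅d, ⁅d, z⁆⁆⁆ := by
  have hlie : ⁅d, ⁅d, ⁅d, z⁆⁆⁆ =
      d * d * d * z - 3 • (d * d * z * d) + 3 • (d * z * d * d) - z * d * d * d := by
    simp only [Ring.lie_def]
    noncomm_ring
  rw [wordSum_vec, hlie]
  linear_combination (norm := module)
      (3 * hA 0 1 2 3 - 3 * hA 0 1 3 2 + 3 * hA 0 2 1 3 - 3 * hA 0 3 1 2 + hA 0 3 2 1 + 3 * hA
        1 0 2 3 - 3 * hA 1 0 3 2 + 3 * hA 1 2 0 3 - hA 1 3 0 2 - hA 1 3 2 0 + 3 * hA 2 0 1 3 + 3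
        * hA 2 1 0 3 - 2 * hA 2 3 0 1) • (d * z * d * d) +
      (-3 * hA 0 1 2 3 + 3 * hA 0 1 3 2 - 3 * hA 0 2 1 3 + 4 * hA 0 3 1 2 - hA 0 3 2 1 - 3 * hA
        1 0 2 3 + 3 * hA 1 0 3 2 - 3 * hA 1 2 0 3 + hA 1 3 0 2 + 2 * hA 1 3 2 0 - 3 * hA 2 0 1 3
        - 3 * hA 2 1 0 3 + 3 * hA 2 3 0 1) • (d * d * z * d) +
      (hA 0 1 2 3 + hA 0 2 1 3 - hA 0 3 1 2 + hA 1 0 2 3 + hA 1 2 0 3 - hA 1 3 2 0 + hA 2 0 1 3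
        + hA 2 1 0 3 - hA 2 3 0 1) • (d * d * d * z)

theorem first_sum_eq_zero [IsAlgClosed K] [CharZero K] (hD : D.trace = 0)
    (h : ∀ a, wordSum c a ≠ D) (i j k l : Fin 4) (hijkl : [i, j, k, l].Nodup := by decide) :
    c l i j k + c l i k j + c l j i k + c l j k i + c l k i j + c l k j i = 0 := by
  obtain ⟨τ, rfl, rfl, rfl, rfl⟩ := exists_perm_of_nodup hijkl
  replace h := wordSum_ne_comp_perm h τ
  generalize hc : (fun i j k l => c (τ i) (τ j) (τ k) (τ l)) = c' at h
  simp only [funext_iff] at hc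
  simp only [hc]
  by_contra hne
  obtain ⟨d, z, hdz⟩ := exists_iterate_lie_eq (D := (-(c' 3 0 1 2 + c' 3 0 2 1 + c' 3 1 0 2 +
    c' 3 1 2 0 + c' 3 2 0 1 + c' 3 2 1 0))⁻¹ • D) (by rw [Matrix.trace_smul, hD, smul_zero]) 3
  refine h ![d, d, d, z] ?_
  change ⁅d, ⁅d, ⁅d, z⁆⁆⁆ = _ at hdz
  rw [wordSum_cube_eq (@insert_sum_eq_zero _ _ _ _ _ _ _ hD h), hdz, smul_smul,
    mul_inv_cancel₀ (neg_ne_zero.2 hne), one_smul]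

theorem add_swap_zero_one_eq_zero [IsAlgClosed K] [CharZero K] (hD : D.trace = 0)
    (h : ∀ a, wordSum c a ≠ D) (i j k l : Fin 4) (hijkl : [i, j, k, l].Nodup := by decide) :
    c i j k l + c j i k l = 0 := by
  obtain ⟨τ, rfl, rfl, rfl, rfl⟩ := exists_perm_of_nodup hijkl
  replace h := wordSum_ne_comp_perm h τ
  generalize hc : (fun i j k l => c (τ i) (τ j) (τ k) (τ l)) = c' at h
  simp only [funext_iff] at hc
  simp only [hc]
  have hA := @insert_sum_eq_zero _ _ _ _ _ _ _ hD h
  linear_combination -hA 0 1 3 2 + hA 0 2 3 1 - hA 0 3 1 2 + hA 0 3 2 1 - hA 1 0 3 2 +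
    hA 1 2 3 0 - hA 2 3 0 1 + first_sum_eq_zero hD h 0 1 3 2

theorem add_swap_two_three_eq_zero [IsAlgClosed K] [CharZero K] (hD : D.trace = 0)
    (h : ∀ a, wordSum c a ≠ D) (i j k l : Fin 4) (hijkl : [i, j, k, l].Nodup := by decide) :
    c i j k l + c i j l k = 0 := by
  obtain ⟨τ, rfl, rfl, rfl, rfl⟩ := exists_perm_of_nodup hijkl
  replace h := wordSum_ne_comp_perm h τ
  generalize hc : (fun i j k l => c (τ i) (τ j) (τ k) (τ l)) = c' at h
  simp only [funext_iff] at hc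
  simp only [hc]
  linear_combination insert_sum_eq_zero hD h 1 2 3 0 + insert_sum_eq_zero hD h 1 3 2 0 -
    first_sum_eq_zero hD h 0 2 3 1

theorem wordSum_square_eq
    (h₁ : ∀ (i j k l : Fin 4) (_ : [i, j, k, l].Nodup := by decide), c i j k l + c j i k l = 0)
    (h₂ : ∀ (i j k l : Fin 4) (_ : [i, j, k, l].Nodup := by decide), c i j k l + c i j l k = 0)
    (d y z : Matrix (Fin n) (Fin n) K) :
    wordSum c ![d, d, y, z] = (c 0 2 1 3 + c 1 2 0 3) • (⁅d, y⁆ * ⁅d, z⁆) +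
      (c 0 3 1 2 + c 1 3 0 2) • (⁅d, z⁆ * ⁅d, y⁆) := by
  have hlie : ∀ y z : Matrix (Fin n) (Fin n) K, ⁅d, y⁆ * ⁅d, z⁆ =
      d * y * d * z - d * y * z * d - y * d * d * z + y * d * z * d := fun y z => by
    simp only [Ring.lie_def]
    noncomm_ring
  rw [wordSum_vec, hlie, hlie]
  linear_combination (norm := module)
      (h₁ 0 1 2 3) • (d * d * y * z) +
      (h₁ 0 1 3 2) • (d * d * z * y) +
      (h₂ 0 2 1 3 + h₂ 1 2 0 3) • (d * y * z * d) +
      (h₂ 0 3 1 2 + h₂ 1 3 0 2) • (d * z * y * d) +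
      (h₁ 0 2 1 3 + h₁ 1 2 0 3) • (y * d * d * z) +
      (-h₂ 0 2 1 3 + h₁ 0 2 3 1 - h₂ 1 2 0 3 + h₁ 1 2 3 0) • (y * d * z * d) +
      (h₂ 2 3 0 1) • (y * z * d * d) +
      (h₁ 0 3 1 2 + h₁ 1 3 0 2) • (z * d * d * y) +
      (-h₂ 0 3 1 2 + h₁ 0 3 2 1 - h₂ 1 3 0 2 + h₁ 1 3 2 0) • (z * d * y * d) +
      (h₁ 2 3 0 1 - h₂ 2 3 0 1 + h₁ 2 3 1 0) • (z * y * d * d)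

theorem add_swap_zero_two_eq_zero [IsAlgClosed K] [CharZero K] (hn : 3 ≤ n)
    (hD : D.trace = 0) (h : ∀ a, wordSum c a ≠ D)
    (i j k l : Fin 4) (hijkl : [i, j, k, l].Nodup := by decide) :
    c i j k l + c k j i l = 0 := by
  have hikjl : [i, k, j, l].Nodup := by
    refine (List.Perm.nodup_iff ?_).1 hijkl
    exact (List.Perm.swap k j [l]).cons i
  obtain ⟨τ, rfl, rfl, rfl, rfl⟩ := exists_perm_of_nodup hikjl
  replace h := wordSum_ne_comp_perm h τ
  generalize hc : (fun i j k l => c (τ i) (τ j) (τ k) (τ l)) = c' at h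
  simp only [funext_iff] at hc
  simp only [hc]
  by_contra hne
  obtain ⟨d, y, z, hdyz⟩ := exists_smul_lie_mul_lie_add_eq hn (a := c' 0 2 1 3 + c' 1 2 0 3)
    (b := c' 0 3 1 2 + c' 1 3 0 2) (.inl hne) hD
  refine h ![d, d, y, z] ?_
  rw [wordSum_square_eq (@add_swap_zero_one_eq_zero _ _ _ _ _ _ _ hD h)
    (@add_swap_two_three_eq_zero _ _ _ _ _ _ _ hD h), hdyz]

theorem exists_wordSum_eq [IsAlgClosed K] [CharZero K] (hn : 3 ≤ n)
    (hc : ∃ i j k l, [i, j, k, l].Nodup ∧ c i j k l ≠ 0)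
    (hD : D.trace = 0) (hD0 : D ≠ 0) :
    ∃ a : Fin 4 → Matrix (Fin n) (Fin n) K, wordSum c a = D := by
  obtain ⟨i, j, k, l, hijkl, hne⟩ := hc
  by_contra! h
  obtain ⟨τ, rfl, rfl, rfl, rfl⟩ := exists_perm_of_nodup hijkl
  replace h := wordSum_ne_comp_perm h τ
  generalize hc : (fun i j k l => c (τ i) (τ j) (τ k) (τ l)) = c' at h
  simp only [funext_iff] at hc
  rw [hc] at hne
  obtain ⟨x, y, z, hxyz⟩ := exists_lie_lie_lie_lie_eq hn (D := (c' 0 1 2 3)⁻¹ • D)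
    (by rw [Matrix.trace_smul, hD, smul_zero]) (smul_ne_zero (inv_ne_zero hne) hD0)
  refine h ![x, x * x, y, z] ?_
  have h₁ := @add_swap_zero_one_eq_zero _ _ _ _ _ _ _ hD h
  have h₂ := @add_swap_zero_two_eq_zero _ _ _ _ _ _ _ hn hD h
  have h₃ := @add_swap_two_three_eq_zero _ _ _ _ _ _ _ hD h
  have e1023 : c' 1 0 2 3 = -c' 0 1 2 3 := by linear_combination h₁ 0 1 2 3
  have e2103 : c' 2 1 0 3 = -c' 0 1 2 3 := by linear_combination h₂ 0 1 2 3
  have e0132 : c' 0 1 3 2 = -c' 0 1 2 3 := by linear_combination h₃ 0 1 2 3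
  have e2013 : c' 2 0 1 3 = c' 0 1 2 3 := by linear_combination h₂ 1 0 2 3 - e1023
  have e1032 : c' 1 0 3 2 = c' 0 1 2 3 := by linear_combination h₃ 1 0 2 3 - e1023
  have e1203 : c' 1 2 0 3 = c' 0 1 2 3 := by linear_combination h₁ 2 1 0 3 - e2103
  have e2130 : c' 2 1 3 0 = c' 0 1 2 3 := by linear_combination h₃ 2 1 0 3 - e2103
  have e3102 : c' 3 1 0 2 = c' 0 1 2 3 := by linear_combination h₂ 0 1 3 2 - e0132
  have e0213 : c' 0 2 1 3 = -c' 0 1 2 3 := by linear_combination h₁ 2 0 1 3 - e2013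
  have e2031 : c' 2 0 3 1 = -c' 0 1 2 3 := by linear_combination h₃ 2 0 1 3 - e2013
  have e3012 : c' 3 0 1 2 = -c' 0 1 2 3 := by linear_combination h₂ 1 0 3 2 - e1032
  have e1230 : c' 1 2 3 0 = -c' 0 1 2 3 := by linear_combination h₃ 1 2 0 3 - e1203
  have e3120 : c' 3 1 2 0 = -c' 0 1 2 3 := by linear_combination h₂ 2 1 3 0 - e2130
  have e1302 : c' 1 3 0 2 = -c' 0 1 2 3 := by linear_combination h₁ 3 1 0 2 - e3102
  have e0231 : c' 0 2 3 1 = c' 0 1 2 3 := by linear_combination h₃ 0 2 1 3 - e0213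
  have e3021 : c' 3 0 2 1 = c' 0 1 2 3 := by linear_combination h₂ 2 0 3 1 - e2031
  have e0312 : c' 0 3 1 2 = c' 0 1 2 3 := by linear_combination h₁ 3 0 1 2 - e3012
  have e3210 : c' 3 2 1 0 = c' 0 1 2 3 := by linear_combination h₂ 1 2 3 0 - e1230
  have e1320 : c' 1 3 2 0 = c' 0 1 2 3 := by linear_combination h₁ 3 1 2 0 - e3120
  have e3201 : c' 3 2 0 1 = -c' 0 1 2 3 := by linear_combination h₂ 0 2 3 1 - e0231
  have e0321 : c' 0 3 2 1 = -c' 0 1 2 3 := by linear_combination h₁ 3 0 2 1 - e3021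
  have e2310 : c' 2 3 1 0 = -c' 0 1 2 3 := by linear_combination h₁ 3 2 1 0 - e3210
  have e2301 : c' 2 3 0 1 = c' 0 1 2 3 := by linear_combination h₁ 3 2 0 1 - e3201
  rw [wordSum_vec, e1023, e2103, e0132, e2013, e1032, e1203, e2130, e3102, e0213, e2031,
    e3012, e1230, e3120, e1302, e0231, e3021, e0312, e3210, e1320, e3201, e0321, e2310, e2301]
  have hlie : ⁅x, ⁅⁅x, y⁆, ⁅x, z⁆⁆⁆ =
      x * (x * x) * y * z - x * (x * x) * z * y - x * y * (x * x) * z +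
      x * y * z * (x * x) + x * z * (x * x) * y - x * z * y * (x * x) -
      (x * x) * x * y * z + (x * x) * x * z * y + (x * x) * y * x * z -
      (x * x) * y * z * x - (x * x) * z * x * y + (x * x) * z * y * x +
      y * x * (x * x) * z - y * x * z * (x * x) - y * (x * x) * x * z +
      y * (x * x) * z * x + y * z * x * (x * x) - y * z * (x * x) * x -
      z * x * (x * x) * y + z * x * y * (x * x) + z * (x * x) * x * y -
      z * (x * x) * y * x - z * y * x * (x * x) + z * y * (x * x) * x := by
    simp only [Ring.lie_def]
    noncomm_ring
  rw [← one_smul K D, ← mul_inv_cancel₀ hne, mul_smul, ← hxyz, hlie]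
  module
end

theorem exists_mlEval_eq_wordSum {K : Type*} [Field K] (α : Equiv.Perm (Fin 4) → K) :
    ∃ c : Fin 4 → Fin 4 → Fin 4 → Fin 4 → K, (∀ σ, α σ = c (σ 0) (σ 1) (σ 2) (σ 3)) ∧
      ∀ {R : Type*} [Ring R] [Algebra K R] (a : Fin 4 → R), mlEval α a = wordSum c a := by
  let c : (Fin 4 → Fin 4) → K := Function.extend
    (fun σ : Equiv.Perm (Fin 4) => (σ : Fin 4 → Fin 4)) α fun _ => 0
  have hc : ∀ σ : Equiv.Perm (Fin 4), α σ = c ![σ 0, σ 1, σ 2, σ 3] := fun σ => by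
    have h : ![σ 0, σ 1, σ 2, σ 3] = ⇑σ := by
      ext i
      fin_cases i <;> rfl
    rw [h]
    exact (DFunLike.coe_injective.extend_apply α _ σ).symm
  refine ⟨fun i j k l => c ![i, j, k, l], hc, fun a => ?_⟩
  refine Finset.sum_congr rfl fun σ _ => ?_
  rw [hc σ]
  simp [List.ofFn_succ, mul_assoc]

theorem stmt_18 (K : Type*) [Field K] [IsAlgClosed K] [CharZero K]
    (n : ℕ) (hn : 3 ≤ n) (α : Equiv.Perm (Fin 4) → K) (hα : α ≠ 0)
    (D : Matrix (Fin n) (Fin n) K) (hD : Matrix.trace D = 0) :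
    ∃ a : Fin 4 → Matrix (Fin n) (Fin n) K, mlEval α a = D := by
  by_cases hD0 : D = 0
  · refine ⟨0, ?_⟩
    rw [hD0]
    simp [mlEval, List.ofFn_succ]
  obtain ⟨c, hc, hmlEval⟩ := exists_mlEval_eq_wordSum α
  obtain ⟨σ, hσ⟩ := Function.ne_iff.1 hα
  obtain ⟨a, ha⟩ := exists_wordSum_eq hn (c := c)
    ⟨σ 0, σ 1, σ 2, σ 3, by simp [List.nodup_cons, σ.injective.eq_iff], by rwa [← hc]⟩ hD hD0
  exact ⟨a, by rw [hmlEval, ha]⟩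
end
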